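/- arXiv:1512.00419 — 5 statements merged into one kernel-verified Lean document; each statement's English description precedes it below -/
import Mathlib

section
/- (Entangled value equals the minimal tensor norm.) Let G = (G_{x,y}^{a,b}) be a two-player game. Then ω*(G) equals the supremum, over all integers d ≥ 1 and families of matrices (T_x^a)_{x∈X,a∈A} and (S_y^b)_{y∈Y,b∈B} in M_d(ℂ) satisfying: for every x, every integer k ≥ 1 and every family of unitaries (U_a)_{a∈A} ⊂ M_k(ℂ), ‖Σ_a T_x^a ⊗ U_a‖ ≤ 1, and for every y, every k and every family of unitaries (V_b)_{b∈B} ⊂ M_k(ℂ), ‖Σ_b S_y^b ⊗ V_b‖ ≤ 1, of the operator norm ‖Σ_{x,y,a,b} G_{x,y}^{a,b} T_x^a ⊗ S_y^b‖ in M_{d²}(ℂ). -/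
open scoped ComplexOrder

/-- The `ℓ₂ → ℓ₂` operator norm of a complex matrix. -/
noncomputable def opNorm {I J : Type*} [Fintype I] [Fintype J]
    (M : Matrix I J ℂ) : ℝ :=
  sSup {r : ℝ | ∃ v : J → ℂ, (∑ j, ‖v j‖ ^ 2 ≤ 1) ∧
    r = Real.sqrt (∑ i, ‖M.mulVec v i‖ ^ 2)}

/-- The entangled value of the two-player game `G`: supremum over all dimensions
`d ≥ 1`, unit vectors `ψ ∈ ℂ^d ⊗ ℂ^d` and POVM measurements. -/
noncomputable def gameQVal {nx ny na nb : ℕ}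
    (G : Fin nx → Fin ny → Fin na → Fin nb → ℝ) : ℝ :=
  sSup {r : ℝ | ∃ (d : ℕ) (ψ : Fin d × Fin d → ℂ)
      (A : Fin nx → Fin na → Matrix (Fin d) (Fin d) ℂ)
      (B : Fin ny → Fin nb → Matrix (Fin d) (Fin d) ℂ),
    1 ≤ d ∧ (∑ p, ‖ψ p‖ ^ 2 = 1) ∧
    (∀ x a, (A x a).PosSemidef) ∧ (∀ x, ∑ a, A x a = 1) ∧
    (∀ y b, (B y b).PosSemidef) ∧ (∀ y, ∑ b, B y b = 1) ∧
    r = (∑ x, ∑ y, ∑ a, ∑ b, (G x y a b : ℂ) *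
          ∑ p : Fin d × Fin d, ∑ q : Fin d × Fin d,
            (starRingEnd ℂ) (ψ p) * (A x a p.1 q.1 * B y b p.2 q.2) * ψ q).re}

open Matrix
open scoped Kronecker

section aux
open scoped Matrix.Norms.L2Operator

lemma aux_norm_toLp {I : Type*} [Fintype I] (v : I → ℂ) :
    ‖(WithLp.toLp 2 v : EuclideanSpace ℂ I)‖ = Real.sqrt (∑ i, ‖v i‖ ^ 2) := by
  rw [EuclideanSpace.norm_eq]

lemma aux_opNorm_eq {I : Type*} [Fintype I] [DecidableEq I] (M : Matrix I I ℂ) :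
    opNorm M = ‖M‖ := by
  rw [Matrix.cstar_norm_def, ← ContinuousLinearMap.sSup_unitClosedBall_eq_norm, opNorm]
  congr 1
  ext r
  constructor
  · rintro ⟨v, hv, rfl⟩
    refine ⟨WithLp.toLp 2 v, ?_, ?_⟩
    · rw [mem_closedBall_zero_iff, aux_norm_toLp]
      exact Real.sqrt_le_one.mpr hv
    · simp only [Matrix.toEuclideanCLM_toLp]
      rw [aux_norm_toLp]
  · rintro ⟨v, hv, rfl⟩
    refine ⟨WithLp.ofLp v, ?_, ?_⟩
    · rw [mem_closedBall_zero_iff, EuclideanSpace.norm_eq] at hv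
      exact Real.sqrt_le_one.mp hv
    · simp only [EuclideanSpace.norm_eq, Matrix.ofLp_toEuclideanCLM]

lemma aux_inner {I : Type*} [Fintype I] (φ ψ : I → ℂ) :
    star φ ⬝ᵥ ψ = inner ℂ (WithLp.toLp 2 φ : EuclideanSpace ℂ I) (WithLp.toLp 2 ψ) := by
  rw [EuclideanSpace.inner_toLp_toLp, dotProduct_comm]

lemma aux_self {I : Type*} [Fintype I] (φ : I → ℂ) :
    (star φ ⬝ᵥ φ).re = ∑ i, ‖φ i‖ ^ 2 := by
  simp [dotProduct, ← Complex.normSq_eq_norm_sq, Complex.normSq_apply]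

lemma aux_le_opNorm {I : Type*} [Fintype I] [DecidableEq I] (M : Matrix I I ℂ) (φ ψ : I → ℂ) :
    (star φ ⬝ᵥ M *ᵥ ψ).re ≤
      opNorm M * (Real.sqrt (∑ i, ‖φ i‖ ^ 2) * Real.sqrt (∑ i, ‖ψ i‖ ^ 2)) := by
  rw [aux_opNorm_eq, aux_inner, ← aux_norm_toLp, ← aux_norm_toLp]
  refine (re_inner_le_norm (𝕜 := ℂ) _ _).trans ?_
  have := (toEuclideanCLM (n := I) (𝕜 := ℂ) M).le_opNorm (WithLp.toLp 2 ψ)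
  rw [toEuclideanCLM_toLp, Matrix.l2_opNorm_toEuclideanCLM] at this
  calc _ ≤ _ := mul_le_mul_of_nonneg_left this (norm_nonneg _)
    _ = _ := by ring

lemma aux_opNorm_nonneg {I : Type*} [Fintype I] [DecidableEq I] (M : Matrix I I ℂ) :
    0 ≤ opNorm M := by
  rw [aux_opNorm_eq]; exact norm_nonneg _

lemma aux_opNorm_le {I : Type*} [Fintype I] [DecidableEq I] (M : Matrix I I ℂ) (c : ℝ)
    (hc : 0 ≤ c) (h : ∀ φ ψ : I → ℂ, 2 * (star φ ⬝ᵥ M *ᵥ ψ).re ≤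
      c * ((star φ ⬝ᵥ φ).re + (star ψ ⬝ᵥ ψ).re)) : opNorm M ≤ c := by
  unfold opNorm
  refine Real.sSup_le ?_ hc
  rintro r ⟨v, hv, rfl⟩
  set r := Real.sqrt (∑ i, ‖(M *ᵥ v) i‖ ^ 2) with hr
  have hr0 : 0 ≤ r := Real.sqrt_nonneg _
  rcases hr0.eq_or_lt with h0 | h0
  · rw [← h0]; exact hc
  have hr2 : r ^ 2 = (star (M *ᵥ v) ⬝ᵥ (M *ᵥ v)).re := by
    rw [aux_self, hr, Real.sq_sqrt (Finset.sum_nonneg fun i _ => by positivity)]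
  have := h ((r⁻¹ : ℝ) • (M *ᵥ v)) v
  rw [star_smul, smul_dotProduct, smul_dotProduct, dotProduct_smul] at this
  simp only [star_trivial, Complex.real_smul, Complex.re_ofReal_mul] at this
  rw [← hr2, aux_self v] at this
  field_simp at this
  nlinarith

end aux

/-- block positivity from a conjugation -/
lemma aux_block {I : Type*} [Fintype I] [DecidableEq I] (W H : Matrix I I ℂ)
    (hH : H.PosSemidef) :
    (fromBlocks (W * H * Wᴴ) (W * H) ((W * H)ᴴ) H).PosSemidef := by
  have h := hH.mul_mul_conjTranspose_same (fromRows W (1 : Matrix I I ℂ))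
  convert h using 1
  rw [conjTranspose_fromRows_eq_fromCols_conjTranspose, fromRows_mul, fromRows_mul_fromCols]
  simp [hH.isHermitian.eq]

/-- tensoring block-positive matrices -/
lemma aux_tensor {I J : Type*} [Fintype I] [Fintype J]
    {P T Q : Matrix I I ℂ} {P' S Q' : Matrix J J ℂ}
    (h : (fromBlocks P T Tᴴ Q).PosSemidef) (h' : (fromBlocks P' S Sᴴ Q').PosSemidef)
    (φ ψ : I × J → ℂ) :
    2 * (star φ ⬝ᵥ (T ⊗ₖ S) *ᵥ ψ).re ≤
      (star φ ⬝ᵥ (P ⊗ₖ P') *ᵥ φ).re + (star ψ ⬝ᵥ (Q ⊗ₖ Q') *ᵥ ψ).re := by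
  classical
  have h1 := (h.kronecker h').submatrix
    (Sum.elim (fun p : I × J => ((Sum.inl p.1 : I ⊕ I), (Sum.inl p.2 : J ⊕ J)))
      (fun p : I × J => (Sum.inr p.1, Sum.inr p.2)))
  have h2 : ((fromBlocks P T Tᴴ Q) ⊗ₖ (fromBlocks P' S Sᴴ Q')).submatrix
    (Sum.elim (fun p : I × J => ((Sum.inl p.1 : I ⊕ I), (Sum.inl p.2 : J ⊕ J)))
      (fun p : I × J => (Sum.inr p.1, Sum.inr p.2)))
    (Sum.elim (fun p : I × J => ((Sum.inl p.1 : I ⊕ I), (Sum.inl p.2 : J ⊕ J)))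
      (fun p : I × J => (Sum.inr p.1, Sum.inr p.2))) =
      fromBlocks (P ⊗ₖ P') (T ⊗ₖ S) ((T ⊗ₖ S)ᴴ) (Q ⊗ₖ Q') := by
    ext (i | i) (j | j) <;> simp [kroneckerMap_apply]
  rw [h2] at h1
  have h3 := h1.dotProduct_mulVec_nonneg (Sum.elim φ (-ψ))
  have h4 : (star ψ ⬝ᵥ (T ⊗ₖ S)ᴴ *ᵥ φ).re = (star φ ⬝ᵥ (T ⊗ₖ S) *ᵥ ψ).re := by
    rw [← Complex.conj_re, ← Complex.star_def, star_dotProduct, star_mulVec, conjTranspose_conjTranspose,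
      star_star, dotProduct_mulVec]
  rw [fromBlocks_mulVec] at h3
  have h5 : star (Sum.elim φ (-ψ)) = Sum.elim (star φ) (-star ψ) := by
    ext (i | i) <;> simp
  rw [h5, sumElim_dotProduct_sumElim] at h3
  have h6 := (Complex.le_def.mp h3).1
  simp [mulVec_neg, dotProduct_add, h4] at h6
  linarith

section polar
open scoped MatrixOrder Matrix.Norms.L2Operator

lemma aux_sqrt {d : ℕ} (M : Matrix (Fin d) (Fin d) ℂ) (hM : M.PosDef) :
    ∃ H : Matrix (Fin d) (Fin d) ℂ, H.PosDef ∧ H * H = M := by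
  have h0 : 0 ≤ M := nonneg_iff_posSemidef.mpr hM.posSemidef
  have h1 : CFC.sqrt M * CFC.sqrt M = M := CFC.sqrt_mul_sqrt_self M h0
  have h2 : (CFC.sqrt M).PosSemidef := nonneg_iff_posSemidef.mp (CFC.sqrt_nonneg M)
  refine ⟨CFC.sqrt M, ?_, h1⟩
  rw [h2.posDef_iff_isUnit]
  have h3 := hM.isUnit
  rw [← h1] at h3
  exact isUnit_of_mul_isUnit_left h3

end polar

lemma aux_eta {d : ℕ} (X : Matrix (Fin d) (Fin d) ℂ) (δ : ℝ) (hδ : 0 < δ) :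
    ∃ η : ℝ, 0 < η ∧ η < δ ∧ IsUnit (X + (η : ℂ) • (1 : Matrix (Fin d) (Fin d) ℂ)) := by
  have hfin : (spectrum ℝ (-X)).Finite := Matrix.finite_real_spectrum
  obtain ⟨η, h1, h2⟩ := ((Set.Ioo_infinite hδ).sdiff hfin).nonempty
  refine ⟨η, h1.1, h1.2, ?_⟩
  rw [spectrum.mem_iff, not_not] at h2
  convert h2 using 1
  rw [Algebra.algebraMap_eq_smul_one, sub_neg_eq_add, add_comm]
  congr 1

lemma aux_polar {d : ℕ} (X : Matrix (Fin d) (Fin d) ℂ) (δ : ℝ) (hδ : 0 < δ) :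
    ∃ W P Q : Matrix (Fin d) (Fin d) ℂ, W ∈ unitaryGroup (Fin d) ℂ ∧
      (fromBlocks P X Xᴴ Q).PosSemidef ∧
      (P.trace + Q.trace).re ≤ 2 * (Wᴴ * X).trace.re + δ := by
  obtain ⟨η, h0, h1, hu⟩ := aux_eta X (δ / (4 * d + 1)) (by positivity)
  set Y := X + (η : ℂ) • (1 : Matrix (Fin d) (Fin d) ℂ) with hY
  have hpd : (Yᴴ * Y).PosDef := by
    rw [(posSemidef_conjTranspose_mul_self Y).posDef_iff_isUnit]
    exact IsUnit.mul (by simpa [star_eq_conjTranspose] using hu.star) hu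
  obtain ⟨H, hH, hHH⟩ := aux_sqrt _ hpd
  have hHi : H * H⁻¹ = 1 := Matrix.mul_nonsing_inv _ ((Matrix.isUnit_iff_isUnit_det _).mp hH.isUnit)
  have hHi' : H⁻¹ * H = 1 := Matrix.nonsing_inv_mul _ ((Matrix.isUnit_iff_isUnit_det _).mp hH.isUnit)
  have hHherm : H⁻¹ᴴ = H⁻¹ := hH.inv.isHermitian.eq
  have hWW : (Y * H⁻¹)ᴴ * (Y * H⁻¹) = 1 := by
    rw [conjTranspose_mul, hHherm]
    calc H⁻¹ * Yᴴ * (Y * H⁻¹) = H⁻¹ * (Yᴴ * Y) * H⁻¹ := by simp only [Matrix.mul_assoc]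
      _ = (H⁻¹ * H) * (H * H⁻¹) := by rw [← hHH]; simp only [Matrix.mul_assoc]
      _ = 1 := by rw [hHi, hHi', one_mul]
  have hWH : (Y * H⁻¹) * H = Y := by rw [Matrix.mul_assoc, hHi', mul_one]
  set W := Y * H⁻¹ with hW
  have hWu : W ∈ unitaryGroup (Fin d) ℂ := by
    rw [mem_unitaryGroup_iff']; exact hWW
  have hη : ((η : ℂ) • (1 : Matrix (Fin d) (Fin d) ℂ)).PosSemidef :=
    PosSemidef.one.smul (by exact_mod_cast h0.le)
  refine ⟨W, W * H * Wᴴ + (η : ℂ) • 1, H + (η : ℂ) • 1, hWu, ?_, ?_⟩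
  · have b1 := aux_block W H hH.posSemidef
    have b2 := aux_block (-1) _ hη
    have := b1.add b2
    rw [fromBlocks_add, hWH] at this
    convert this using 2
    · simp [hWH]
    · simp [hY]
    · simp [hY]
  · have e1 : (W * H * Wᴴ).trace = H.trace := by
      rw [Matrix.trace_mul_comm, ← Matrix.mul_assoc, hWW, one_mul]
    have e2 : H = Wᴴ * X + (η : ℂ) • Wᴴ := by
      have : Wᴴ * Y = H := by rw [← hWH, ← Matrix.mul_assoc, hWW, one_mul]
      rw [← this, hY, Matrix.mul_add, Matrix.mul_smul, mul_one]
    have e3 : Wᴴ.trace.re ≤ d := by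
      rw [Matrix.trace, Complex.re_sum]
      calc _ ≤ ∑ i : Fin d, (1 : ℝ) := Finset.sum_le_sum fun i _ => by
            refine (Complex.re_le_norm _).trans ?_
            simpa using entry_norm_bound_of_unitary hWu i i
        _ = d := by simp
    have e4 : (Matrix.trace H).re = (Wᴴ * X).trace.re + η * Wᴴ.trace.re := by
      conv_lhs => rw [e2]
      rw [Matrix.trace_add, Matrix.trace_smul]; simp
    rw [Matrix.trace_add, Matrix.trace_add, e1, Matrix.trace_smul, Matrix.trace_one]
    simp only [Complex.add_re, e4, smul_eq_mul, Complex.re_ofReal_mul, Fintype.card_fin, Complex.natCast_re]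
    have e5 : η * (4 * d + 1) < δ := by
      rwa [lt_div_iff₀ (by positivity)] at h1
    have e6 : η * Wᴴ.trace.re ≤ η * d := mul_le_mul_of_nonneg_left e3 h0.le
    nlinarith

lemma aux_vec {d : ℕ} (R T S W : Matrix (Fin d) (Fin d) ℂ) :
    star (fun p : Fin d × Fin d => R p.1 p.2) ⬝ᵥ (T ⊗ₖ (W.map star)) *ᵥ
      (fun p : Fin d × Fin d => S p.1 p.2) = (Wᴴ * (Rᴴ * T * S)).trace := by
  have h : (T ⊗ₖ (W.map star)) *ᵥ (fun p : Fin d × Fin d => S p.1 p.2) =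
      fun p => (T * S * Wᴴ) p.1 p.2 := by
    ext p
    simp only [mulVec, dotProduct, Fintype.sum_prod_type, kroneckerMap_apply, Matrix.mul_apply,
      Matrix.map_apply, conjTranspose_apply, Finset.sum_mul]
    rw [Finset.sum_comm]
    refine Finset.sum_congr rfl fun i _ => Finset.sum_congr rfl fun j _ => by ring
  have e : Rᴴ * T * S * Wᴴ = Rᴴ * (T * S * Wᴴ) := by simp only [Matrix.mul_assoc]
  rw [h, Matrix.trace_mul_comm, e]
  generalize T * S * Wᴴ = Z
  simp only [dotProduct, Fintype.sum_prod_type, Matrix.trace, diag_apply, Matrix.mul_apply,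
    conjTranspose_apply, Pi.star_apply]
  rw [Finset.sum_comm]

lemma aux_rep {d : ℕ} (g : Matrix (Fin d) (Fin d) ℂ →ₗ[ℂ] ℂ) :
    ∃ ρ : Matrix (Fin d) (Fin d) ℂ, ∀ M, g M = (ρ * M).trace := by
  refine ⟨Matrix.of fun j i => g (Matrix.single i j 1), fun M => ?_⟩
  conv_lhs => rw [matrix_eq_sum_single M]
  simp only [map_sum, Matrix.trace, diag_apply, Matrix.mul_apply, of_apply]
  rw [Finset.sum_comm]
  refine Finset.sum_congr rfl fun i _ => Finset.sum_congr rfl fun j _ => ?_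
  have : Matrix.single j i (M j i) = (M j i) • Matrix.single j i (1 : ℂ) := by simp
  rw [this, map_smul, smul_eq_mul, mul_comm]

lemma aux_ray (r u : ℝ) (h : ∀ t : ℝ, 0 ≤ t → -(t * r) < u) : 0 ≤ r := by
  by_contra hr
  push Not at hr
  have := h (|u| / (-r)) (div_nonneg (abs_nonneg _) (by linarith))
  have e : -(|u| / (-r) * r) = |u| := by
    have := hr.ne
    field_simp
  rw [e] at this
  exact absurd (le_abs_self u) (not_le.mpr this)

/-- positive functional from the Hermitian part -/
lemma aux_herm {d : ℕ} (ρ : Matrix (Fin d) (Fin d) ℂ)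
    (h : ∀ M : Matrix (Fin d) (Fin d) ℂ, M.PosSemidef → 0 ≤ (ρ * M).trace.re) :
    ∃ σ : Matrix (Fin d) (Fin d) ℂ, σ.PosSemidef ∧
      ∀ M : Matrix (Fin d) (Fin d) ℂ, M.IsHermitian → (ρ * M).trace.re = (σ * M).trace.re := by
  have key : ∀ M : Matrix (Fin d) (Fin d) ℂ, M.IsHermitian →
      (ρ * M).trace.re = (((1 / 2 : ℂ) • (ρ + ρᴴ)) * M).trace.re := by
    intro M hM
    have : (ρᴴ * M).trace.re = (ρ * M).trace.re := by
      conv_lhs => rw [← hM.eq, ← conjTranspose_mul, trace_conjTranspose, Matrix.trace_mul_comm]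
      simp
    rw [Matrix.smul_mul, Matrix.trace_smul, Matrix.add_mul, Matrix.trace_add]
    have e : (1 / 2 : ℂ) = ((1 / 2 : ℝ) : ℂ) := by norm_num
    rw [e, smul_eq_mul, Complex.re_ofReal_mul, Complex.add_re, this]
    ring
  refine ⟨(1 / 2 : ℂ) • (ρ + ρᴴ), ?_, key⟩
  have hh : ((1 / 2 : ℂ) • (ρ + ρᴴ)).IsHermitian := by
    simp [IsHermitian, conjTranspose_smul, add_comm]
  refine PosSemidef.of_dotProduct_mulVec_nonneg hh fun v => ?_
  rw [Complex.le_def]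
  refine ⟨?_, ?_⟩
  · have h1 := posSemidef_vecMulVec_self_star v
    have h2 := h _ h1
    rw [key _ h1.isHermitian, mul_vecMulVec, trace_vecMulVec, dotProduct_comm] at h2
    exact h2
  · have := hh.im_star_dotProduct_mulVec_self v
    simpa using this.symm

lemma aux_block_add {I : Type*} [Fintype I] {P T Q P' T' Q' : Matrix I I ℂ}
    (h : (fromBlocks P T Tᴴ Q).PosSemidef) (h' : (fromBlocks P' T' T'ᴴ Q').PosSemidef) :
    (fromBlocks (P + P') (T + T') (T + T')ᴴ (Q + Q')).PosSemidef := by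
  have := h.add h'
  rwa [fromBlocks_add, ← conjTranspose_add] at this

lemma aux_block_smul {I : Type*} [Fintype I] {P T Q : Matrix I I ℂ}
    (h : (fromBlocks P T Tᴴ Q).PosSemidef) (c : ℝ) (hc : 0 ≤ c) :
    (fromBlocks (c • P) (c • T) (c • T)ᴴ (c • Q)).PosSemidef := by
  have := h.smul hc
  rw [fromBlocks_smul] at this
  rw [conjTranspose_smul]
  exact this

lemma aux_block_left {I : Type*} [Fintype I] {P T Q : Matrix I I ℂ}
    (h : (fromBlocks P T Tᴴ Q).PosSemidef) : P.PosSemidef := h.submatrix Sum.inl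

lemma aux_block_right {I : Type*} [Fintype I] {P T Q : Matrix I I ℂ}
    (h : (fromBlocks P T Tᴴ Q).PosSemidef) : Q.PosSemidef := h.submatrix Sum.inr

lemma aux_block_conj {I : Type*} [Fintype I] {P T Q : Matrix I I ℂ} (R S : Matrix I I ℂ)
    (hR : R.IsHermitian) (hS : S.IsHermitian)
    (h : (fromBlocks P T Tᴴ Q).PosSemidef) :
    (fromBlocks (R * P * R) (R * T * S) (R * T * S)ᴴ (S * Q * S)).PosSemidef := by
  have := h.mul_mul_conjTranspose_same (fromBlocks R 0 0 S)
  rw [fromBlocks_conjTranspose, fromBlocks_multiply, fromBlocks_multiply] at this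
  simp only [conjTranspose_zero, Matrix.zero_mul, Matrix.mul_zero, add_zero, zero_add, hR.eq, hS.eq]
    at this
  rw [conjTranspose_mul, conjTranspose_mul, hR.eq, hS.eq, ← Matrix.mul_assoc]
  exact this

section dis
open scoped Matrix.Norms.L2Operator Pointwise

lemma aux_ball_psd {d : ℕ} (c : ℝ) (M B K : Matrix (Fin d) (Fin d) ℂ) (hM : M.IsHermitian)
    (hB : ‖B‖ ≤ c) (hK : K.PosSemidef) (h : B - K = M) :
    ((c : ℂ) • (1 : Matrix (Fin d) (Fin d) ℂ) - M).PosSemidef := by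
  have hh : ((c : ℂ) • (1 : Matrix (Fin d) (Fin d) ℂ) - M).IsHermitian := by
    refine IsHermitian.sub ?_ hM
    simp [IsHermitian, conjTranspose_smul]
  refine PosSemidef.of_dotProduct_mulVec_nonneg hh fun v => ?_
  rw [Complex.le_def]
  refine ⟨?_, by simpa using (hh.im_star_dotProduct_mulVec_self v).symm⟩
  have h1 := aux_le_opNorm B v v
  rw [aux_opNorm_eq, Real.mul_self_sqrt (Finset.sum_nonneg fun i _ => by positivity)] at h1
  have h2 := (Complex.le_def.mp (hK.dotProduct_mulVec_nonneg v)).1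
  have h3 := aux_self v
  have h4 : 0 ≤ ∑ i, ‖v i‖ ^ 2 := Finset.sum_nonneg fun i _ => by positivity
  rw [← h, sub_mulVec, sub_mulVec, smul_mulVec, one_mulVec, dotProduct_sub, dotProduct_sub,
    dotProduct_smul, smul_eq_mul]
  simp only [Complex.sub_re, Complex.re_ofReal_mul, Complex.zero_re] at h2 ⊢
  rw [h3]
  nlinarith

lemma aux_sep {d n : ℕ} (T : Fin n → Matrix (Fin d) (Fin d) ℂ) (ε : ℝ) (hε : 0 < ε)
    (hno : ¬ ∃ P Q : Fin n → Matrix (Fin d) (Fin d) ℂ,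
      (∀ a, (fromBlocks (P a) (T a) (T a)ᴴ (Q a)).PosSemidef) ∧
      (((1 + ε : ℝ) : ℂ) • (1 : Matrix (Fin d) (Fin d) ℂ) - ∑ a, P a).PosSemidef ∧
      (((1 + ε : ℝ) : ℂ) • (1 : Matrix (Fin d) (Fin d) ℂ) - ∑ a, Q a).PosSemidef) :
    ∃ (ρ σ : Matrix (Fin d) (Fin d) ℂ) (u : ℝ), ρ.PosSemidef ∧ σ.PosSemidef ∧
      ρ.trace.re + σ.trace.re < u ∧
      ∀ P Q : Fin n → Matrix (Fin d) (Fin d) ℂ,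
        (∀ a, (fromBlocks (P a) (T a) (T a)ᴴ (Q a)).PosSemidef) →
        u ≤ (ρ * ∑ a, P a).trace.re + (σ * ∑ a, Q a).trace.re := by
  let C : Set (Matrix (Fin d) (Fin d) ℂ × Matrix (Fin d) (Fin d) ℂ) := {p | (-p.1).PosSemidef ∧ (-p.2).PosSemidef}
  let F : Set (Matrix (Fin d) (Fin d) ℂ × Matrix (Fin d) (Fin d) ℂ) := {p | ∃ P Q : Fin n → Matrix (Fin d) (Fin d) ℂ,
      (∀ a, (fromBlocks (P a) (T a) (T a)ᴴ (Q a)).PosSemidef) ∧ p = (∑ a, P a, ∑ a, Q a)}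
  let s : Set (Matrix (Fin d) (Fin d) ℂ × Matrix (Fin d) (Fin d) ℂ) := Metric.ball 0 (1 + ε) + C
  have hCc : Convex ℝ C := by
    rintro p ⟨hp1, hp2⟩ q ⟨hq1, hq2⟩ a b ha hb hab
    refine ⟨?_, ?_⟩
    · have := (hp1.smul ha).add (hq1.smul hb)
      convert this using 1
      change -(a • p.1 + b • q.1) = _
      simp [add_comm]
    · have := (hp2.smul ha).add (hq2.smul hb)
      convert this using 1
      change -(a • p.2 + b • q.2) = _
      simp [add_comm]
  have hsc : Convex ℝ s := (convex_ball _ _).add hCc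
  have hso : IsOpen s := Metric.isOpen_ball.add_right
  have hFc : Convex ℝ F := by
    rintro _ ⟨P, Q, h, rfl⟩ _ ⟨P', Q', h', rfl⟩ a b ha hb hab
    refine ⟨fun i => a • P i + b • P' i, fun i => a • Q i + b • Q' i, fun i => ?_, ?_⟩
    · have := aux_block_add (aux_block_smul (h i) a ha) (aux_block_smul (h' i) b hb)
      rwa [← add_smul, hab, one_smul] at this
    · simp [Finset.sum_add_distrib, Finset.smul_sum]
  have hdis : Disjoint s F := by
    rw [Set.disjoint_left]
    rintro _ ⟨B, hB, K, hK, rfl⟩ ⟨P, Q, h, he⟩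
    apply hno
    rw [mem_ball_zero_iff, Prod.norm_def, max_lt_iff] at hB
    have he1 : B.1 + K.1 = ∑ a, P a := congrArg Prod.fst he
    have he2 : B.2 + K.2 = ∑ a, Q a := congrArg Prod.snd he
    refine ⟨P, Q, h, ?_, ?_⟩
    · exact aux_ball_psd _ _ B.1 (-K.1)
        (posSemidef_sum _ fun a _ => aux_block_left (h a)).isHermitian hB.1.le hK.1
        (by rw [sub_neg_eq_add, he1])
    · exact aux_ball_psd _ _ B.2 (-K.2)
        (posSemidef_sum _ fun a _ => aux_block_right (h a)).isHermitian hB.2.le hK.2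
        (by rw [sub_neg_eq_add, he2])
  obtain ⟨f, u, hf1, hf2⟩ := RCLike.geometric_hahn_banach_open (𝕜 := ℂ) hsc hso hFc hdis
  obtain ⟨ρ, hρ⟩ := aux_rep (f.toLinearMap ∘ₗ LinearMap.inl ℂ _ _)
  obtain ⟨σ, hσ⟩ := aux_rep (f.toLinearMap ∘ₗ LinearMap.inr ℂ _ _)
  have hf : ∀ M N, (f (M, N)).re = (ρ * M).trace.re + (σ * N).trace.re := by
    intro M N
    rw [← hρ, ← hσ, ← Complex.add_re]
    rw [LinearMap.comp_apply, LinearMap.comp_apply, ← map_add]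
    simp
  have hs0 : ∀ K L : Matrix (Fin d) (Fin d) ℂ, K.PosSemidef → L.PosSemidef →
      (f (-K, -L)).re < u := by
    intro K L hK hL
    refine hf1 _ ⟨0, by simp; linarith, (-K, -L), ⟨by simpa using hK, by simpa using hL⟩, by simp⟩
  have hρ0 : ∀ M : Matrix (Fin d) (Fin d) ℂ, M.PosSemidef → 0 ≤ (ρ * M).trace.re := by
    intro M hM
    refine aux_ray _ u fun t ht => ?_
    have := hs0 (t • M) 0 (hM.smul ht) PosSemidef.zero
    rw [hf] at this
    simpa using this
  have hσ0 : ∀ M : Matrix (Fin d) (Fin d) ℂ, M.PosSemidef → 0 ≤ (σ * M).trace.re := by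
    intro M hM
    refine aux_ray _ u fun t ht => ?_
    have := hs0 0 (t • M) PosSemidef.zero (hM.smul ht)
    rw [hf] at this
    simpa using this
  obtain ⟨ρ', hρ', hρe⟩ := aux_herm ρ hρ0
  obtain ⟨σ', hσ', hσe⟩ := aux_herm σ hσ0
  refine ⟨ρ', σ', u, hρ', hσ', ?_, ?_⟩
  · have h1 : (f (1, 1)).re < u := by
      refine hf1 _ ⟨(1, 1), ?_, 0, ⟨by simpa using PosSemidef.zero, by simpa using PosSemidef.zero⟩, by simp⟩
      have hone : ‖(1 : Matrix (Fin d) (Fin d) ℂ)‖ ≤ 1 := by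
        rw [← aux_opNorm_eq]
        refine aux_opNorm_le _ _ zero_le_one fun φ ψ => ?_
        have := aux_self (φ - ψ)
        have h0 : 0 ≤ ∑ i, ‖(φ - ψ) i‖ ^ 2 := Finset.sum_nonneg fun i _ => by positivity
        have h3 : (star ψ ⬝ᵥ φ).re = (star φ ⬝ᵥ ψ).re := by
          rw [← Complex.conj_re, ← Complex.star_def, star_dotProduct, star_star, dotProduct_comm]
        rw [one_mulVec, one_mul]
        simp only [star_sub, sub_dotProduct, dotProduct_sub, Complex.sub_re, h3] at this
        linarith
      rw [mem_ball_zero_iff, Prod.norm_def, max_lt_iff]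
      exact ⟨by linarith, by linarith⟩
    rw [hf, hρe _ isHermitian_one, hσe _ isHermitian_one, mul_one, mul_one] at h1
    exact h1
  · intro P Q h
    have := hf2 (∑ a, P a, ∑ a, Q a) ⟨P, Q, h, rfl⟩
    rw [← hρe _ (posSemidef_sum _ fun a _ => aux_block_left (h a)).isHermitian,
      ← hσe _ (posSemidef_sum _ fun a _ => aux_block_right (h a)).isHermitian, ← hf]
    exact this

end dis

lemma aux_key0 {d n : ℕ} (T : Fin n → Matrix (Fin d) (Fin d) ℂ)
    (h : ∀ U : Fin n → Matrix (Fin d) (Fin d) ℂ, (∀ a, U a ∈ unitaryGroup (Fin d) ℂ) →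
      opNorm (∑ a, (T a) ⊗ₖ (U a)) ≤ 1) (ε : ℝ) (hε : 0 < ε) :
    ∃ P Q : Fin n → Matrix (Fin d) (Fin d) ℂ,
      (∀ a, (fromBlocks (P a) (T a) (T a)ᴴ (Q a)).PosSemidef) ∧
      (((1 + ε : ℝ) : ℂ) • (1 : Matrix (Fin d) (Fin d) ℂ) - ∑ a, P a).PosSemidef ∧
      (((1 + ε : ℝ) : ℂ) • (1 : Matrix (Fin d) (Fin d) ℂ) - ∑ a, Q a).PosSemidef := by
  by_contra hno
  obtain ⟨ρ, σ, u, hρ, hσ, hlt, hF⟩ := aux_sep T ε hε hno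
  set δ := (u - (ρ.trace.re + σ.trace.re)) / (2 * d + n + 1) with hδdef
  have hδ : 0 < δ := div_pos (by linarith) (by positivity)
  have hδe : δ * (2 * d + n + 1) = u - (ρ.trace.re + σ.trace.re) := by
    rw [hδdef]; field_simp
  have hδ1 : ((δ : ℂ) • (1 : Matrix (Fin d) (Fin d) ℂ)).PosDef :=
    PosDef.one.smul (by exact_mod_cast hδ)
  obtain ⟨R, hR, hRR⟩ := aux_sqrt _ (hδ1.posSemidef_add hρ)
  obtain ⟨S, hS, hSS⟩ := aux_sqrt _ (hδ1.posSemidef_add hσ)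
  choose W P Q hW hPQ htr using fun a => aux_polar (R * T a * S) δ hδ
  have inv1 : ∀ H : Matrix (Fin d) (Fin d) ℂ, H.PosDef → H * H⁻¹ = 1 := fun H hH =>
    Matrix.mul_nonsing_inv _ ((Matrix.isUnit_iff_isUnit_det _).mp hH.isUnit)
  have inv2 : ∀ H : Matrix (Fin d) (Fin d) ℂ, H.PosDef → H⁻¹ * H = 1 := fun H hH =>
    Matrix.nonsing_inv_mul _ ((Matrix.isUnit_iff_isUnit_det _).mp hH.isUnit)
  have hblk : ∀ a, (fromBlocks (R⁻¹ * P a * R⁻¹) (T a) (T a)ᴴ (S⁻¹ * Q a * S⁻¹)).PosSemidef := by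
    intro a
    have := aux_block_conj R⁻¹ S⁻¹ hR.inv.isHermitian hS.inv.isHermitian (hPQ a)
    have e : R⁻¹ * (R * T a * S) * S⁻¹ = T a := by
      calc R⁻¹ * (R * T a * S) * S⁻¹ = (R⁻¹ * R) * T a * (S * S⁻¹) := by
            simp only [Matrix.mul_assoc]
        _ = T a := by rw [inv2 R hR, inv1 S hS, one_mul, mul_one]
    rwa [e] at this
  have hu := hF _ _ hblk
  -- compare the perturbed traces
  have hpert : ∀ (τ H : Matrix (Fin d) (Fin d) ℂ) (p : Fin n → Matrix (Fin d) (Fin d) ℂ),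
      H.PosDef → H * H = τ + (δ : ℂ) • 1 → (∀ a, (H⁻¹ * p a * H⁻¹).PosSemidef) →
      (τ * ∑ a, H⁻¹ * p a * H⁻¹).trace.re ≤ ∑ a, (p a).trace.re := by
    intro τ H p hH hHH hp
    have e1 : τ = H * H - (δ : ℂ) • 1 := by rw [hHH]; simp
    have e2 : (H * H * ∑ a, H⁻¹ * p a * H⁻¹).trace = ∑ a, (p a).trace := by
      rw [Finset.mul_sum, Matrix.trace_sum]
      refine Finset.sum_congr rfl fun a _ => ?_
      calc (H * H * (H⁻¹ * p a * H⁻¹)).trace = (H * (H * H⁻¹) * p a * H⁻¹).trace := by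
            simp only [Matrix.mul_assoc]
        _ = (H⁻¹ * (H * p a)).trace := by
            rw [inv1 H hH, mul_one, Matrix.trace_mul_comm]
        _ = (p a).trace := by rw [← Matrix.mul_assoc, inv2 H hH, one_mul]
    have e3 := (Complex.le_def.mp (posSemidef_sum Finset.univ fun a _ => hp a).trace_nonneg).1
    rw [e1, Matrix.sub_mul, Matrix.trace_sub, e2, Matrix.smul_mul, one_mul, Matrix.trace_smul,
      Complex.sub_re, smul_eq_mul, Complex.re_ofReal_mul, Complex.re_sum]
    have := mul_nonneg hδ.le e3
    linarith
  have h1 := hpert ρ R P hR hRR fun a => aux_block_left (hblk a)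
  have h2 := hpert σ S Q hS hSS fun a => aux_block_right (hblk a)
  have h3 : ∑ a, (P a).trace.re + ∑ a, (Q a).trace.re ≤
      2 * ∑ a, ((W a)ᴴ * (R * T a * S)).trace.re + n * δ := by
    rw [← Finset.sum_add_distrib, Finset.mul_sum]
    calc _ ≤ ∑ a, (2 * ((W a)ᴴ * (R * T a * S)).trace.re + δ) :=
          Finset.sum_le_sum fun a _ => by simpa using htr a
      _ = _ := by simp [Finset.sum_add_distrib]
  have hWu : ∀ a, (W a).map star ∈ unitaryGroup (Fin d) ℂ := by
    intro a
    have e := mem_unitaryGroup_iff.mp (hW a)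
    rw [mem_unitaryGroup_iff]
    have := congrArg (fun M : Matrix (Fin d) (Fin d) ℂ => M.map (starRingEnd ℂ)) e
    simp only [Matrix.map_mul] at this
    rw [Matrix.map_one _ (map_zero _) (map_one _)] at this
    exact this
  have h4 := aux_le_opNorm (∑ a, (T a) ⊗ₖ ((W a).map star))
    (fun p => R p.1 p.2) (fun p => S p.1 p.2)
  rw [sum_mulVec, dotProduct_sum, Complex.re_sum] at h4
  simp only [aux_vec, hR.isHermitian.eq] at h4
  have h5 := h _ hWu
  have hn : ∀ (τ H : Matrix (Fin d) (Fin d) ℂ), H.PosDef → H * H = τ + (δ : ℂ) • 1 →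
      ∑ p : Fin d × Fin d, ‖H p.1 p.2‖ ^ 2 = τ.trace.re + d * δ := by
    intro τ H hH hHH
    have e1 : (H * H).trace.re = τ.trace.re + d * δ := by
      rw [hHH, Matrix.trace_add, Matrix.trace_smul, Matrix.trace_one]
      simp [mul_comm]
    have e2 : (Hᴴ * H).trace.re = ∑ p : Fin d × Fin d, ‖H p.1 p.2‖ ^ 2 := by
      rw [← aux_self (fun p : Fin d × Fin d => H p.1 p.2)]
      simp only [dotProduct, Fintype.sum_prod_type, Matrix.trace, diag_apply, Matrix.mul_apply,
        conjTranspose_apply, Pi.star_apply]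
      rw [Finset.sum_comm]
    rw [← e2, hH.isHermitian.eq, e1]
  set x := Real.sqrt (∑ p : Fin d × Fin d, ‖R p.1 p.2‖ ^ 2) with hx
  set y := Real.sqrt (∑ p : Fin d × Fin d, ‖S p.1 p.2‖ ^ 2) with hy
  have hx2 : x ^ 2 = ρ.trace.re + d * δ := by
    rw [hx, Real.sq_sqrt (Finset.sum_nonneg fun i _ => by positivity), hn ρ R hR hRR]
  have hy2 : y ^ 2 = σ.trace.re + d * δ := by
    rw [hy, Real.sq_sqrt (Finset.sum_nonneg fun i _ => by positivity), hn σ S hS hSS]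
  have hxy : 0 ≤ x * y := mul_nonneg (Real.sqrt_nonneg _) (Real.sqrt_nonneg _)
  have h6 := mul_le_mul_of_nonneg_right h5 hxy
  nlinarith [sq_nonneg (x - y)]

lemma aux_fix {d n : ℕ} (a0 : Fin n) (c : ℝ) (P : Fin n → Matrix (Fin d) (Fin d) ℂ) :
    ∑ a, (P a + if a = a0 then ((c : ℂ) • (1 : Matrix (Fin d) (Fin d) ℂ) - ∑ a, P a) else 0) =
      (c : ℂ) • 1 := by
  simp [Finset.sum_add_distrib]

lemma aux_key {d n : ℕ} (a0 : Fin n) (T : Fin n → Matrix (Fin d) (Fin d) ℂ)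
    (h : ∀ U : Fin n → Matrix (Fin d) (Fin d) ℂ, (∀ a, U a ∈ unitaryGroup (Fin d) ℂ) →
      opNorm (∑ a, (T a) ⊗ₖ (U a)) ≤ 1) (ε : ℝ) (hε : 0 < ε) :
    ∃ P Q : Fin n → Matrix (Fin d) (Fin d) ℂ,
      (∀ a, (P a).PosSemidef) ∧ (∀ a, (Q a).PosSemidef) ∧ ∑ a, P a = 1 ∧ ∑ a, Q a = 1 ∧
      ∀ a, (fromBlocks ((1 + ε) • P a) (T a) (T a)ᴴ ((1 + ε) • Q a)).PosSemidef := by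
  obtain ⟨P, Q, hb, hP, hQ⟩ := aux_key0 T h ε hε
  have hc : (1 + ε) ≠ 0 := by positivity
  have hci : 0 ≤ (1 + ε)⁻¹ := by positivity
  let P' := fun a => P a + if a = a0 then
    (((1 + ε : ℝ) : ℂ) • (1 : Matrix (Fin d) (Fin d) ℂ) - ∑ a, P a) else 0
  let Q' := fun a => Q a + if a = a0 then
    (((1 + ε : ℝ) : ℂ) • (1 : Matrix (Fin d) (Fin d) ℂ) - ∑ a, Q a) else 0
  have hb' : ∀ a, (fromBlocks (P' a) (T a) (T a)ᴴ (Q' a)).PosSemidef := by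
    intro a
    by_cases ha : a = a0
    · have e : (fromBlocks (((1 + ε : ℝ) : ℂ) • (1 : Matrix (Fin d) (Fin d) ℂ) - ∑ a, P a) 0 0ᴴ
          (((1 + ε : ℝ) : ℂ) • (1 : Matrix (Fin d) (Fin d) ℂ) - ∑ a, Q a)).PosSemidef := by
        have b1 := aux_block 0 _ hQ
        have b2 := (aux_block 0 _ hP).submatrix Sum.swap
        have := b1.add b2
        convert this using 1
        ext (i | i) (j | j) <;> simp
      have := aux_block_add (hb a) e
      simpa [P', Q', ha] using this
    · simpa [P', Q', ha] using hb a
  have hs : ∀ X : Matrix (Fin d) (Fin d) ℂ, (1 + ε)⁻¹ • (((1 + ε : ℝ) : ℂ) • X) = X := by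
    intro X
    have : (((1 + ε : ℝ) : ℂ) • X) = (1 + ε) • X := by ext; simp
    rw [this, inv_smul_smul₀ hc]
  refine ⟨fun a => (1 + ε)⁻¹ • P' a, fun a => (1 + ε)⁻¹ • Q' a,
    fun a => (aux_block_left (hb' a)).smul hci, fun a => (aux_block_right (hb' a)).smul hci,
    ?_, ?_, fun a => ?_⟩
  · rw [← Finset.smul_sum, aux_fix, hs]
  · rw [← Finset.smul_sum, aux_fix, hs]
  · simp only [smul_inv_smul₀ hc]
    exact hb' a

lemma aux_quad {d : ℕ} (A B : Matrix (Fin d) (Fin d) ℂ) (ψ : Fin d × Fin d → ℂ) :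
    ∑ p : Fin d × Fin d, ∑ q : Fin d × Fin d,
      (starRingEnd ℂ) (ψ p) * (A p.1 q.1 * B p.2 q.2) * ψ q =
      star ψ ⬝ᵥ (A ⊗ₖ B) *ᵥ ψ := by
  simp only [dotProduct, mulVec, Finset.mul_sum, kroneckerMap_apply, Pi.star_apply]
  refine Finset.sum_congr rfl fun p _ => Finset.sum_congr rfl fun q _ => ?_
  simp only [starRingEnd_apply]
  ring

lemma aux_val {nx ny na nb d : ℕ} (G : Fin nx → Fin ny → Fin na → Fin nb → ℝ)
    (A : Fin nx → Fin na → Matrix (Fin d) (Fin d) ℂ)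
    (B : Fin ny → Fin nb → Matrix (Fin d) (Fin d) ℂ) (ψ : Fin d × Fin d → ℂ) :
    (∑ x, ∑ y, ∑ a, ∑ b, (G x y a b : ℂ) *
          ∑ p : Fin d × Fin d, ∑ q : Fin d × Fin d,
            (starRingEnd ℂ) (ψ p) * (A x a p.1 q.1 * B y b p.2 q.2) * ψ q).re =
      ∑ x, ∑ y, ∑ a, ∑ b, G x y a b * (star ψ ⬝ᵥ (A x a ⊗ₖ B y b) *ᵥ ψ).re := by
  simp only [aux_quad, Complex.re_sum, Complex.re_ofReal_mul]

lemma aux_expand {nx ny na nb : ℕ} {I : Type*} [Fintype I]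
    (G : Fin nx → Fin ny → Fin na → Fin nb → ℝ)
    (K : Fin nx → Fin ny → Fin na → Fin nb → Matrix I I ℂ) (φ ψ : I → ℂ) :
    (star φ ⬝ᵥ (∑ x, ∑ y, ∑ a, ∑ b, (G x y a b : ℂ) • K x y a b) *ᵥ ψ).re =
      ∑ x, ∑ y, ∑ a, ∑ b, G x y a b * (star φ ⬝ᵥ K x y a b *ᵥ ψ).re := by
  simp only [sum_mulVec, dotProduct_sum, smul_mulVec, dotProduct_smul, Complex.re_sum,
    smul_eq_mul, Complex.re_ofReal_mul]

lemma aux_quad_nonneg {d : ℕ} {A B : Matrix (Fin d) (Fin d) ℂ} (hA : A.PosSemidef)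
    (hB : B.PosSemidef) (ψ : Fin d × Fin d → ℂ) : 0 ≤ (star ψ ⬝ᵥ (A ⊗ₖ B) *ᵥ ψ).re :=
  (Complex.le_def.mp ((hA.kronecker hB).dotProduct_mulVec_nonneg ψ)).1

lemma aux_quad_sum {d n m : ℕ} (A : Fin n → Matrix (Fin d) (Fin d) ℂ)
    (B : Fin m → Matrix (Fin d) (Fin d) ℂ) (ψ : Fin d × Fin d → ℂ)
    (hA : ∑ a, A a = 1) (hB : ∑ b, B b = 1) :
    ∑ a, ∑ b, (star ψ ⬝ᵥ (A a ⊗ₖ B b) *ᵥ ψ).re = (star ψ ⬝ᵥ ψ).re := by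
  have : ∑ a, ∑ b, (A a ⊗ₖ B b) = 1 := by
    have e : (∑ a, A a) ⊗ₖ (∑ b, B b) = 1 := by rw [hA, hB, one_kronecker_one]
    rw [← e]
    ext p q
    simp only [Matrix.sum_apply, kroneckerMap_apply, Finset.sum_mul_sum]
  have h : star ψ ⬝ᵥ ψ = star ψ ⬝ᵥ (∑ a, ∑ b, (A a ⊗ₖ B b)) *ᵥ ψ := by rw [this, one_mulVec]
  rw [h]
  simp only [sum_mulVec, dotProduct_sum, Complex.re_sum]

lemma aux_value_le_one {nx ny na nb d : ℕ} (G : Fin nx → Fin ny → Fin na → Fin nb → ℝ)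
    (hpos : ∀ x y a b, 0 ≤ G x y a b)
    (hnorm : ∑ x, ∑ y, ∑ a, ∑ b, G x y a b = 1)
    (A : Fin nx → Fin na → Matrix (Fin d) (Fin d) ℂ)
    (B : Fin ny → Fin nb → Matrix (Fin d) (Fin d) ℂ) (ψ : Fin d × Fin d → ℂ)
    (hψ : ∑ p, ‖ψ p‖ ^ 2 = 1)
    (hA : ∀ x a, (A x a).PosSemidef) (hA1 : ∀ x, ∑ a, A x a = 1)
    (hB : ∀ y b, (B y b).PosSemidef) (hB1 : ∀ y, ∑ b, B y b = 1) :
    ∑ x, ∑ y, ∑ a, ∑ b, G x y a b * (star ψ ⬝ᵥ (A x a ⊗ₖ B y b) *ᵥ ψ).re ≤ 1 := by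
  rw [← hnorm]
  refine Finset.sum_le_sum fun x _ => Finset.sum_le_sum fun y _ =>
    Finset.sum_le_sum fun a _ => Finset.sum_le_sum fun b _ => ?_
  have h1 := aux_quad_sum (A x) (B y) ψ (hA1 x) (hB1 y)
  rw [aux_self, hψ] at h1
  have h2 : (star ψ ⬝ᵥ (A x a ⊗ₖ B y b) *ᵥ ψ).re ≤ 1 := by
    rw [← h1]
    refine (Finset.single_le_sum (f := fun b => (star ψ ⬝ᵥ (A x a ⊗ₖ B y b) *ᵥ ψ).re)
      (fun b _ => aux_quad_nonneg (hA x a) (hB y b) ψ) (Finset.mem_univ b)).trans ?_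
    exact Finset.single_le_sum (f := fun a => ∑ b, (star ψ ⬝ᵥ (A x a ⊗ₖ B y b) *ᵥ ψ).re)
      (fun a _ => Finset.sum_nonneg fun b _ => aux_quad_nonneg (hA x a) (hB y b) ψ)
      (Finset.mem_univ a)
  nlinarith [hpos x y a b]

lemma aux_le_val {nx ny na nb d : ℕ} (hd : 1 ≤ d) (G : Fin nx → Fin ny → Fin na → Fin nb → ℝ)
    (hpos : ∀ x y a b, 0 ≤ G x y a b)
    (hnorm : ∑ x, ∑ y, ∑ a, ∑ b, G x y a b = 1)
    (A : Fin nx → Fin na → Matrix (Fin d) (Fin d) ℂ)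
    (B : Fin ny → Fin nb → Matrix (Fin d) (Fin d) ℂ) (ψ : Fin d × Fin d → ℂ)
    (hA : ∀ x a, (A x a).PosSemidef) (hA1 : ∀ x, ∑ a, A x a = 1)
    (hB : ∀ y b, (B y b).PosSemidef) (hB1 : ∀ y, ∑ b, B y b = 1) :
    ∑ x, ∑ y, ∑ a, ∑ b, G x y a b * (star ψ ⬝ᵥ (A x a ⊗ₖ B y b) *ᵥ ψ).re ≤
      gameQVal G * (star ψ ⬝ᵥ ψ).re := by
  rw [aux_self]
  set N := ∑ p, ‖ψ p‖ ^ 2 with hN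
  have hN0 : 0 ≤ N := Finset.sum_nonneg fun i _ => by positivity
  rcases hN0.eq_or_lt with h0 | h0
  · have hz : ψ = 0 := by
      ext p
      have := (Finset.sum_eq_zero_iff_of_nonneg (fun i _ => by positivity)).mp (hN.symm.trans h0.symm) p
        (Finset.mem_univ p)
      simpa using this
    rw [← h0, hz]
    simp
  set c := (Real.sqrt N)⁻¹ with hc
  have hc2 : c * c = N⁻¹ := by
    rw [hc, ← mul_inv, Real.mul_self_sqrt hN0]
  have hmem : ∑ x, ∑ y, ∑ a, ∑ b, G x y a b *
      (star (c • ψ) ⬝ᵥ (A x a ⊗ₖ B y b) *ᵥ (c • ψ)).re ≤ gameQVal G := by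
    refine le_csSup ⟨1, ?_⟩ ⟨d, c • ψ, A, B, hd, ?_, hA, hA1, hB, hB1, (aux_val G A B _).symm⟩
    · rintro r ⟨d, ψ, A, B, hd, hψ, hA, hA1, hB, hB1, rfl⟩
      rw [aux_val]
      exact aux_value_le_one G hpos hnorm A B ψ hψ hA hA1 hB hB1
    · have : ∀ p, ‖(c • ψ) p‖ ^ 2 = N⁻¹ * ‖ψ p‖ ^ 2 := by
        intro p
        rw [Pi.smul_apply, norm_smul, mul_pow, Real.norm_eq_abs, sq_abs, sq, hc2]
      rw [Finset.sum_congr rfl fun p _ => this p, ← Finset.mul_sum, ← hN, inv_mul_cancel₀ h0.ne']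
  have e : ∀ M : Matrix (Fin d × Fin d) (Fin d × Fin d) ℂ,
      (star (c • ψ) ⬝ᵥ M *ᵥ (c • ψ)).re = N⁻¹ * (star ψ ⬝ᵥ M *ᵥ ψ).re := by
    intro M
    rw [star_smul, mulVec_smul, smul_dotProduct, dotProduct_smul, smul_smul, star_trivial, hc2]
    simp
  simp only [e, mul_left_comm _ N⁻¹, ← Finset.mul_sum] at hmem
  rwa [inv_mul_le_iff₀ h0, mul_comm N] at hmem

lemma aux_val_nonneg {nx ny na nb : ℕ} (G : Fin nx → Fin ny → Fin na → Fin nb → ℝ)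
    (hpos : ∀ x y a b, 0 ≤ G x y a b) : 0 ≤ gameQVal G := by
  refine Real.sSup_nonneg ?_
  rintro r ⟨d, ψ, A, B, hd, hψ, hA, hA1, hB, hB1, rfl⟩
  rw [aux_val]
  exact Finset.sum_nonneg fun x _ => Finset.sum_nonneg fun y _ => Finset.sum_nonneg fun a _ =>
    Finset.sum_nonneg fun b _ => mul_nonneg (hpos x y a b) (aux_quad_nonneg (hA x a) (hB y b) ψ)

lemma aux_povm {d n k : ℕ} (A : Fin n → Matrix (Fin d) (Fin d) ℂ)
    (hA : ∀ a, (A a).PosSemidef) (hA1 : ∑ a, A a = 1)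
    (U : Fin n → Matrix (Fin k) (Fin k) ℂ) (hU : ∀ a, U a ∈ unitaryGroup (Fin k) ℂ) :
    opNorm (∑ a, (A a) ⊗ₖ (U a)) ≤ 1 := by
  refine aux_opNorm_le _ _ zero_le_one fun φ ψ => ?_
  have hsum : ∑ a, (A a) ⊗ₖ (1 : Matrix (Fin k) (Fin k) ℂ) = 1 := by
    rw [← one_kronecker_one, ← hA1]
    ext p q
    simp only [Matrix.sum_apply, kroneckerMap_apply, Finset.sum_mul]
  have hq : ∀ χ : Fin d × Fin k → ℂ, ∑ a, (star χ ⬝ᵥ ((A a) ⊗ₖ (1 : Matrix (Fin k) (Fin k) ℂ)) *ᵥ χ).re =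
      (star χ ⬝ᵥ χ).re := by
    intro χ
    rw [← Complex.re_sum, ← dotProduct_sum, ← sum_mulVec, hsum, one_mulVec]
  rw [one_mul, sum_mulVec, dotProduct_sum, Complex.re_sum, Finset.mul_sum, ← hq φ, ← hq ψ,
    ← Finset.sum_add_distrib]
  refine Finset.sum_le_sum fun a _ => ?_
  have b1 := aux_block 1 (A a) (hA a)
  have b2 := aux_block (U a) 1 PosSemidef.one
  have hUU : U a * (U a)ᴴ = 1 := mem_unitaryGroup_iff.mp (hU a)
  rw [one_mul, conjTranspose_one, mul_one] at b1
  rw [mul_one, hUU] at b2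
  exact aux_tensor b1 b2 φ ψ

lemma aux_main {nx ny na nb d : ℕ} (hd : 1 ≤ d) (G : Fin nx → Fin ny → Fin na → Fin nb → ℝ)
    (hpos : ∀ x y a b, 0 ≤ G x y a b)
    (hnorm : ∑ x, ∑ y, ∑ a, ∑ b, G x y a b = 1) (a0 : Fin na) (b0 : Fin nb)
    (T : Fin nx → Fin na → Matrix (Fin d) (Fin d) ℂ)
    (S : Fin ny → Fin nb → Matrix (Fin d) (Fin d) ℂ)
    (hT : ∀ (x : Fin nx) (U : Fin na → Matrix (Fin d) (Fin d) ℂ),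
      (∀ a, U a ∈ unitaryGroup (Fin d) ℂ) → opNorm (∑ a, (T x a) ⊗ₖ (U a)) ≤ 1)
    (hS : ∀ (y : Fin ny) (U : Fin nb → Matrix (Fin d) (Fin d) ℂ),
      (∀ a, U a ∈ unitaryGroup (Fin d) ℂ) → opNorm (∑ a, (S y a) ⊗ₖ (U a)) ≤ 1) :
    opNorm (∑ x, ∑ y, ∑ a, ∑ b, (G x y a b : ℂ) • ((T x a) ⊗ₖ (S y b))) ≤ gameQVal G := by
  have hω := aux_val_nonneg G hpos
  have key : ∀ ε : ℝ, 0 < ε → opNorm (∑ x, ∑ y, ∑ a, ∑ b, (G x y a b : ℂ) • ((T x a) ⊗ₖ (S y b))) ≤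
      (1 + ε) ^ 2 * gameQVal G := by
    intro ε hε
    choose P Q hP hQ hP1 hQ1 hb using fun x => aux_key a0 (T x) (hT x) ε hε
    choose P' Q' hP' hQ' hP1' hQ1' hb' using fun y => aux_key b0 (S y) (hS y) ε hε
    refine aux_opNorm_le _ _ (by positivity) fun φ ψ => ?_
    have h1 := aux_le_val hd G hpos hnorm P P' φ hP hP1 hP' hP1'
    have h2 := aux_le_val hd G hpos hnorm Q Q' ψ hQ hQ1 hQ' hQ1'
    rw [aux_expand]
    have h3 : 2 * ∑ x, ∑ y, ∑ a, ∑ b, G x y a b * (star φ ⬝ᵥ (T x a ⊗ₖ S y b) *ᵥ ψ).re ≤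
        (1 + ε) ^ 2 * (∑ x, ∑ y, ∑ a, ∑ b, G x y a b * (star φ ⬝ᵥ (P x a ⊗ₖ P' y b) *ᵥ φ).re +
          ∑ x, ∑ y, ∑ a, ∑ b, G x y a b * (star ψ ⬝ᵥ (Q x a ⊗ₖ Q' y b) *ᵥ ψ).re) := by
      simp only [← Finset.sum_add_distrib, Finset.mul_sum]
      refine Finset.sum_le_sum fun x _ => Finset.sum_le_sum fun y _ =>
        Finset.sum_le_sum fun a _ => Finset.sum_le_sum fun b _ => ?_
      have h4 := aux_tensor (hb x a) (hb' y b) φ ψ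
      have e : ∀ (A B : Matrix (Fin d) (Fin d) ℂ) (χ : Fin d × Fin d → ℂ),
          (star χ ⬝ᵥ (((1 + ε) • A) ⊗ₖ ((1 + ε) • B)) *ᵥ χ).re =
            (1 + ε) ^ 2 * (star χ ⬝ᵥ (A ⊗ₖ B) *ᵥ χ).re := by
        intro A B χ
        rw [smul_kronecker, kronecker_smul, smul_smul, smul_mulVec, dotProduct_smul, sq,
          Complex.real_smul, Complex.re_ofReal_mul]
      rw [e, e] at h4
      have := mul_le_mul_of_nonneg_left h4 (hpos x y a b)
      linarith
    refine h3.trans ?_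
    rw [mul_assoc]
    refine mul_le_mul_of_nonneg_left ?_ (by positivity)
    linarith
  refine le_of_forall_pos_le_add fun δ hδ => ?_
  set ω := gameQVal G
  have hε : 0 < min 1 (δ / (3 * ω + 1)) := by positivity
  refine (key _ hε).trans ?_
  set ε := min 1 (δ / (3 * ω + 1))
  have h1 : ε ≤ 1 := min_le_left _ _
  have h2 : ε * (3 * ω + 1) ≤ δ := (le_div_iff₀ (by positivity)).mp (min_le_right _ _)
  nlinarith [mul_nonneg hε.le hω, mul_nonneg (mul_nonneg hε.le hω) (sub_nonneg.mpr h1)]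

/-- entangled value equals the minimal tensor norm: for a two-player
game `G`, `ω*(G)` equals the supremum of `‖Σ G_{x,y}^{a,b} T_x^a ⊗ S_y^b‖` over all
families `(T_x^a)`, `(S_y^b)` satisfying `‖Σ_a T_x^a ⊗ U_a‖ ≤ 1` for all families of
unitaries `(U_a)` (in any dimension `k ≥ 1`), and similarly for `(S_y^b)`. -/
theorem stmt10 {nx ny na nb : ℕ}
    (G : Fin nx → Fin ny → Fin na → Fin nb → ℝ)
    (hpos : ∀ x y a b, 0 ≤ G x y a b)
    (hnorm : ∑ x, ∑ y, ∑ a, ∑ b, G x y a b = 1) :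
    gameQVal G =
      sSup {r : ℝ | ∃ (d : ℕ)
          (T : Fin nx → Fin na → Matrix (Fin d) (Fin d) ℂ)
          (S : Fin ny → Fin nb → Matrix (Fin d) (Fin d) ℂ),
        1 ≤ d ∧
        (∀ (x : Fin nx) (k : ℕ) (U : Fin na → Matrix (Fin k) (Fin k) ℂ),
          1 ≤ k → (∀ a, U a ∈ Matrix.unitaryGroup (Fin k) ℂ) →
          opNorm (∑ a, Matrix.kroneckerMap (· * ·) (T x a) (U a)) ≤ 1) ∧
        (∀ (y : Fin ny) (k : ℕ) (V : Fin nb → Matrix (Fin k) (Fin k) ℂ),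
          1 ≤ k → (∀ b, V b ∈ Matrix.unitaryGroup (Fin k) ℂ) →
          opNorm (∑ b, Matrix.kroneckerMap (· * ·) (S y b) (V b)) ≤ 1) ∧
        r = opNorm (∑ x, ∑ y, ∑ a, ∑ b,
              (G x y a b : ℂ) • Matrix.kroneckerMap (· * ·) (T x a) (S y b))} := by
  have hex : Nonempty (Fin na) ∧ Nonempty (Fin nb) := by
    constructor
    · by_contra h
      rw [not_nonempty_iff] at h
      simp at hnorm
    · by_contra h
      rw [not_nonempty_iff] at h
      simp at hnorm
  obtain ⟨⟨a0⟩, ⟨b0⟩⟩ := hex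
  apply le_antisymm
  · refine Real.sSup_le ?_ (Real.sSup_nonneg ?_)
    · rintro r ⟨d, ψ, A, B, hd, hψ, hA, hA1, hB, hB1, rfl⟩
      rw [aux_val]
      have h1 : ∑ x, ∑ y, ∑ a, ∑ b, G x y a b * (star ψ ⬝ᵥ (A x a ⊗ₖ B y b) *ᵥ ψ).re ≤
          opNorm (∑ x, ∑ y, ∑ a, ∑ b, (G x y a b : ℂ) • ((A x a) ⊗ₖ (B y b))) := by
        have := aux_le_opNorm (∑ x, ∑ y, ∑ a, ∑ b, (G x y a b : ℂ) • ((A x a) ⊗ₖ (B y b))) ψ ψ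
        rwa [aux_expand, hψ, Real.sqrt_one, mul_one, mul_one] at this
      refine h1.trans (le_csSup ⟨gameQVal G, ?_⟩ ⟨d, A, B, hd, ?_, ?_, rfl⟩)
      · rintro r ⟨d, T, S, hd, hT, hS, rfl⟩
        exact aux_main hd G hpos hnorm a0 b0 T S (fun x U hU => hT x d U hd hU)
          (fun y U hU => hS y d U hd hU)
      · intro x k U _ hU
        exact aux_povm (A x) (hA x) (hA1 x) U hU
      · intro y k V _ hV
        exact aux_povm (B y) (hB y) (hB1 y) V hV
    · rintro r ⟨d, T, S, hd, hT, hS, rfl⟩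
      exact aux_opNorm_nonneg _
  · refine Real.sSup_le ?_ (aux_val_nonneg G hpos)
    rintro r ⟨d, T, S, hd, hT, hS, rfl⟩
    exact aux_main hd G hpos hnorm a0 b0 T S (fun x U hU => hT x d U hd hU)
      (fun y U hU => hS y d U hd hU)
end

section
/- For every two-player game G with input sets X, Y (of sizes |X|, |Y|) and output sets A, B, the entangled value satisfies ω*(G) ≤ min(|X|, |Y|) · ω(G). -/
open scoped ComplexOrder

/-- The classical value of the two-player game `G`: the best value over deterministic
strategies `f : X → A`, `g : Y → B`. -/
noncomputable def gameCVal {nx ny na nb : ℕ}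
    (G : Fin nx → Fin ny → Fin na → Fin nb → ℝ) : ℝ :=
  sSup {r : ℝ | ∃ (f : Fin nx → Fin na) (g : Fin ny → Fin nb),
    r = ∑ x, ∑ y, G x y (f x) (g y)}

lemma core_bound {X Y A B : Type*} [Fintype X] [Fintype Y] [Fintype A] [Fintype B]
    [Nonempty A] [Nonempty B]
    (G p : X → Y → A → B → ℝ) (q : X → A → ℝ) (W : ℝ)
    (hG : ∀ x y a b, 0 ≤ G x y a b) (hp : ∀ x y a b, 0 ≤ p x y a b)
    (hq0 : ∀ x a, 0 ≤ q x a)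
    (hq : ∀ x y a, ∑ b, p x y a b = q x a) (hq1 : ∀ x, ∑ a, q x a = 1)
    (hW : ∀ (f : X → A) (g : Y → B), ∑ x, ∑ y, G x y (f x) (g y) ≤ W) :
    ∑ x, ∑ y, ∑ a, ∑ b, G x y a b * p x y a b ≤ Fintype.card X * W := by
  have key : ∀ x, ∑ y, ∑ a, ∑ b, G x y a b * p x y a b ≤ W := by
    intro x
    have hm : ∀ a y, ∃ b0, ∀ b, G x y a b ≤ G x y a b0 := fun a y =>
      Finite.exists_max (fun b => G x y a b)
    choose m hm using hm
    have h1 : ∀ a, ∑ y, G x y a (m a y) ≤ W := by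
      intro a
      refine le_trans ?_ (hW (fun _ => a) (m a))
      exact Finset.single_le_sum (f := fun x => ∑ y, G x y a (m a y))
        (fun x _ => Finset.sum_nonneg fun y _ => hG _ _ _ _) (Finset.mem_univ x)
    rw [Finset.sum_comm]
    calc ∑ a, ∑ y, ∑ b, G x y a b * p x y a b
        ≤ ∑ a, ∑ y, G x y a (m a y) * q x a := by
          refine Finset.sum_le_sum fun a _ => Finset.sum_le_sum fun y _ => ?_
          rw [← hq x y a, Finset.mul_sum]
          exact Finset.sum_le_sum fun b _ => mul_le_mul_of_nonneg_right (hm a y b) (hp _ _ _ _)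
      _ ≤ ∑ a, W * q x a := by
          refine Finset.sum_le_sum fun a _ => ?_
          rw [← Finset.sum_mul]
          exact mul_le_mul_of_nonneg_right (h1 a) (hq0 x a)
      _ = W := by rw [← Finset.mul_sum, hq1, mul_one]
  calc _ ≤ ∑ _x : X, W := Finset.sum_le_sum fun x _ => key x
    _ = _ := by simp

/-- The quadratic form of `M ⊗ N` at `ψ`. -/
noncomputable def qform {d : ℕ} (ψ : Fin d × Fin d → ℂ)
    (M N : Matrix (Fin d) (Fin d) ℂ) : ℂ :=
  ∑ p : Fin d × Fin d, ∑ q : Fin d × Fin d,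
            (starRingEnd ℂ) (ψ p) * (M p.1 q.1 * N p.2 q.2) * ψ q

lemma qform_nonneg {d : ℕ} (ψ : Fin d × Fin d → ℂ)
    (M N : Matrix (Fin d) (Fin d) ℂ) (hM : M.PosSemidef) (hN : N.PosSemidef) :
    0 ≤ (qform ψ M N).re := by
  have h := (hM.kronecker hN).dotProduct_mulVec_nonneg ψ
  have e : qform ψ M N = star ψ ⬝ᵥ ((Matrix.kronecker M N).mulVec ψ) := by
    simp [qform, dotProduct, Matrix.mulVec, Finset.mul_sum, mul_assoc]
  rw [e]
  exact (Complex.le_def.1 h).1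

lemma qform_sum_right {d n : ℕ} (ψ : Fin d × Fin d → ℂ)
    (M : Matrix (Fin d) (Fin d) ℂ) (N : Fin n → Matrix (Fin d) (Fin d) ℂ) :
    ∑ b, qform ψ M (N b) = qform ψ M (∑ b, N b) := by
  unfold qform
  rw [Finset.sum_comm]
  refine Finset.sum_congr rfl fun p _ => ?_
  rw [Finset.sum_comm]
  refine Finset.sum_congr rfl fun q _ => ?_
  simp [Matrix.sum_apply, Finset.mul_sum, Finset.sum_mul]

lemma qform_sum_left {d n : ℕ} (ψ : Fin d × Fin d → ℂ)
    (N : Matrix (Fin d) (Fin d) ℂ) (M : Fin n → Matrix (Fin d) (Fin d) ℂ) :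
    ∑ b, qform ψ (M b) N = qform ψ (∑ b, M b) N := by
  unfold qform
  rw [Finset.sum_comm]
  refine Finset.sum_congr rfl fun p _ => ?_
  rw [Finset.sum_comm]
  refine Finset.sum_congr rfl fun q _ => ?_
  simp [Matrix.sum_apply, Finset.mul_sum, Finset.sum_mul]

lemma qform_one {d : ℕ} (ψ : Fin d × Fin d → ℂ) (h : ∑ p, ‖ψ p‖ ^ 2 = 1) :
    (qform ψ 1 1).re = 1 := by
  have e : qform ψ 1 1 = ((∑ p, ‖ψ p‖ ^ 2 : ℝ) : ℂ) := by
    unfold qform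
    push_cast
    refine Finset.sum_congr rfl fun p _ => ?_
    rw [Finset.sum_eq_single p]
    · simp [Complex.conj_mul']
    · intro q _ hq
      by_cases h1 : p.1 = q.1
      · have h2 : p.2 ≠ q.2 := fun h2 => hq (Prod.ext h1.symm h2.symm)
        simp [Matrix.one_apply, h2]
      · simp [Matrix.one_apply, h1]
    · simp
  rw [e, h]; simp

/-- for every two-player game, `ω*(G) ≤ min(|X|, |Y|) · ω(G)`. -/
theorem stmt12 {nx ny na nb : ℕ}
    (G : Fin nx → Fin ny → Fin na → Fin nb → ℝ)
    (hpos : ∀ x y a b, 0 ≤ G x y a b)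
    (hnorm : ∑ x, ∑ y, ∑ a, ∑ b, G x y a b = 1) :
    gameQVal G ≤ (min nx ny : ℕ) * gameCVal G := by
  have hna : Nonempty (Fin na) := by
    by_contra h
    rw [not_nonempty_iff] at h
    simp at hnorm
  have hnb : Nonempty (Fin nb) := by
    by_contra h
    rw [not_nonempty_iff] at h
    simp at hnorm
  have hW : ∀ (f : Fin nx → Fin na) (g : Fin ny → Fin nb),
      ∑ x, ∑ y, G x y (f x) (g y) ≤ gameCVal G := by
    intro f g
    refine le_csSup ?_ ⟨f, g, rfl⟩
    have : (Set.range fun t : (Fin nx → Fin na) × (Fin ny → Fin nb) =>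
      ∑ x, ∑ y, G x y (t.1 x) (t.2 y)).Finite := Set.finite_range _
    refine this.bddAbove.mono ?_
    rintro r ⟨f, g, rfl⟩
    exact ⟨(f, g), rfl⟩
  have hW0 : 0 ≤ gameCVal G := le_trans
    (Finset.sum_nonneg fun x _ => Finset.sum_nonneg fun y _ => hpos _ _ _ _)
    (hW (fun _ => hna.some) (fun _ => hnb.some))
  refine Real.sSup_le ?_ (by positivity)
  rintro r ⟨d, ψ, A, B, hd, hψ, hA, hA1, hB, hB1, rfl⟩
  have e : (∑ x, ∑ y, ∑ a, ∑ b, (G x y a b : ℂ) *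
          ∑ p : Fin d × Fin d, ∑ q : Fin d × Fin d,
            (starRingEnd ℂ) (ψ p) * (A x a p.1 q.1 * B y b p.2 q.2) * ψ q).re
      = ∑ x, ∑ y, ∑ a, ∑ b, G x y a b * (qform ψ (A x a) (B y b)).re := by
    simp only [Complex.re_sum, Complex.re_ofReal_mul, qform]
  rw [e]
  have h1 : ∑ x, ∑ y, ∑ a, ∑ b, G x y a b * (qform ψ (A x a) (B y b)).re
      ≤ nx * gameCVal G := by
    have := core_bound G (fun x y a b => (qform ψ (A x a) (B y b)).re)
      (fun x a => (qform ψ (A x a) 1).re) (gameCVal G) hpos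
      (fun x y a b => qform_nonneg _ _ _ (hA _ _) (hB _ _))
      (fun x a => qform_nonneg _ _ _ (hA _ _) Matrix.PosSemidef.one)
      (fun x y a => by rw [← Complex.re_sum, qform_sum_right, hB1])
      (fun x => by rw [← Complex.re_sum, qform_sum_left, hA1, qform_one ψ hψ]) hW
    simpa using this
  have h2 : ∑ x, ∑ y, ∑ a, ∑ b, G x y a b * (qform ψ (A x a) (B y b)).re
      ≤ ny * gameCVal G := by
    have := core_bound (fun y x b a => G x y a b)
      (fun y x b a => (qform ψ (A x a) (B y b)).re)
      (fun y b => (qform ψ 1 (B y b)).re) (gameCVal G) (fun _ _ _ _ => hpos _ _ _ _)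
      (fun y x b a => qform_nonneg _ _ _ (hA _ _) (hB _ _))
      (fun y b => qform_nonneg _ _ _ Matrix.PosSemidef.one (hB _ _))
      (fun y x b => by rw [← Complex.re_sum, qform_sum_left, hA1])
      (fun y => by rw [← Complex.re_sum, qform_sum_right, hB1, qform_one ψ hψ])
      (fun g f => by rw [Finset.sum_comm]; exact hW f g)
    rw [Fintype.card_fin, Finset.sum_comm] at this
    refine le_trans (le_of_eq ?_) this
    refine Finset.sum_congr rfl fun x _ => Finset.sum_congr rfl fun y _ => ?_
    rw [Finset.sum_comm]
  rcases min_choice nx ny with h | h <;> rw [h] <;> assumption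
end

section
/- There exists a universal constant K > 0 (one may take the complex Grothendieck constant) such that for every two-player game G with output sets A, B (of sizes |A|, |B|), the entangled value satisfies ω*(G) ≤ K · √(|A|·|B|) · ω(G). -/
open scoped ComplexOrder

lemma povm_vec {d n : ℕ} (A : Fin n → Matrix (Fin d) (Fin d) ℂ)
    (hA : ∀ a, (A a).PosSemidef) (h1 : ∑ a, A a = 1) (φ : Fin d → ℂ) :
    ∑ a, ∑ i, ‖(A a).mulVec φ i‖ ^ 2 ≤ ∑ i, ‖φ i‖ ^ 2 := by
  have nrm : ∀ v : Fin d → ℂ, ((∑ i, ‖v i‖ ^ 2 : ℝ) : ℂ) = dotProduct (star v) v := by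
    intro v
    simp only [dotProduct, Pi.star_apply, RCLike.star_def, Complex.conj_mul']
    push_cast; rfl
  have key : ∀ a, ((∑ i, ‖(A a).mulVec φ i‖ ^ 2 : ℝ) : ℂ)
      ≤ dotProduct (star φ) ((A a).mulVec φ) := by
    intro a
    have hle : (1 - A a).PosSemidef := by
      rw [← h1, ← Finset.add_sum_erase _ _ (Finset.mem_univ a), add_sub_cancel_left]
      exact Matrix.posSemidef_sum _ (fun b _ => hA b)
    have hH : (A a).conjTranspose = A a := (hA a).1
    have hH' : (1 - A a).conjTranspose = 1 - A a := hle.1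
    have e1 := hle.conjTranspose_mul_mul_same (A a)
    have e2 := (hA a).conjTranspose_mul_mul_same (1 - A a)
    rw [hH] at e1
    rw [hH'] at e2
    have e3 := e1.add e2
    have e4 : A a * (1 - A a) * A a + (1 - A a) * A a * (1 - A a) = A a - A a * A a := by
      noncomm_ring
    rw [e4] at e3
    have e5 := e3.dotProduct_mulVec_nonneg φ
    rw [Matrix.sub_mulVec, dotProduct_sub, sub_nonneg] at e5
    rw [nrm, Matrix.star_mulVec, hH, ← Matrix.dotProduct_mulVec, Matrix.mulVec_mulVec]
    exact e5
  have h2 := Finset.sum_le_sum (fun a (_ : a ∈ Finset.univ) => key a)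
  rw [← dotProduct_sum, ← Matrix.sum_mulVec, h1, Matrix.one_mulVec, ← nrm] at h2
  exact_mod_cast h2

lemma cs_fin {ι : Type*} [Fintype ι] (u v : ι → ℂ) :
    (∑ i, (starRingEnd ℂ) (u i) * v i).re ≤
      Real.sqrt (∑ i, ‖u i‖ ^ 2) * Real.sqrt (∑ i, ‖v i‖ ^ 2) := by
  refine (Complex.re_le_norm _).trans ((norm_sum_le _ _).trans ?_)
  simp only [norm_mul, RCLike.norm_conj]
  exact Real.sum_mul_le_sqrt_mul_sqrt _ _ _

lemma sum_sqrt_le {n : ℕ} (s : Fin n → ℝ) (hs : ∀ a, 0 ≤ s a) (h : ∑ a, s a ≤ 1) :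
    ∑ a, Real.sqrt (s a) ≤ Real.sqrt n := by
  apply Real.le_sqrt_of_sq_le
  have := sq_sum_le_card_mul_sum_sq (s := (Finset.univ : Finset (Fin n)))
    (f := fun a => Real.sqrt (s a))
  simp only [Real.sq_sqrt (hs _), Finset.card_univ, Fintype.card_fin] at this
  nlinarith [Nat.cast_nonneg (α := ℝ) n]

lemma pick {n m : ℕ} (hm : 0 < m) (H p : Fin n → Fin m → ℝ) (hH : ∀ x a, 0 ≤ H x a)
    (hp : ∀ x a, 0 ≤ p x a) (α : ℝ) (hα : ∀ x, ∑ a, p x a ≤ α) :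
    ∃ f : Fin n → Fin m, ∑ x, ∑ a, p x a * H x a ≤ α * ∑ x, H x (f x) := by
  haveI : Nonempty (Fin m) := ⟨⟨0, hm⟩⟩
  choose f hf using fun x => Finite.exists_max (H x)
  refine ⟨f, ?_⟩
  rw [Finset.mul_sum]
  refine Finset.sum_le_sum fun x _ => ?_
  calc _ ≤ ∑ a, p x a * H x (f x) :=
        Finset.sum_le_sum fun a _ => mul_le_mul_of_nonneg_left (hf x a) (hp x a)
    _ = (∑ a, p x a) * H x (f x) := by rw [Finset.sum_mul]
    _ ≤ _ := mul_le_mul_of_nonneg_right (hα x) (hH _ _)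

lemma cval_ge {nx ny na nb : ℕ} (G : Fin nx → Fin ny → Fin na → Fin nb → ℝ)
    (f : Fin nx → Fin na) (g : Fin ny → Fin nb) :
    ∑ x, ∑ y, G x y (f x) (g y) ≤ gameCVal G := by
  apply le_csSup
  · apply Set.Finite.bddAbove
    refine (Set.finite_range (fun fg : (Fin nx → Fin na) × (Fin ny → Fin nb) =>
      ∑ x, ∑ y, G x y (fg.1 x) (fg.2 y))).subset ?_
    rintro r ⟨f, g, rfl⟩
    exact ⟨(f, g), rfl⟩
  · exact ⟨f, g, rfl⟩

lemma frac {nx ny na nb : ℕ} (ha : 0 < na) (hb : 0 < nb)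
    (G : Fin nx → Fin ny → Fin na → Fin nb → ℝ)
    (hG : ∀ x y a b, 0 ≤ G x y a b) (p : Fin nx → Fin na → ℝ) (q : Fin ny → Fin nb → ℝ)
    (hp : ∀ x a, 0 ≤ p x a) (hq : ∀ x a, 0 ≤ q x a) (α β : ℝ) (h0 : 0 ≤ α) (h0' : 0 ≤ β)
    (hα : ∀ x, ∑ a, p x a ≤ α) (hβ : ∀ x, ∑ a, q x a ≤ β) :
    ∑ x, ∑ y, ∑ a, ∑ b, G x y a b * (p x a * q y b) ≤ α * β * gameCVal G := by
  obtain ⟨f, hf⟩ := pick ha (fun x a => ∑ y, ∑ b, G x y a b * q y b) p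
    (fun x a => Finset.sum_nonneg fun y _ => Finset.sum_nonneg fun b _ =>
      mul_nonneg (hG _ _ _ _) (hq _ _)) hp α hα
  obtain ⟨g, hg⟩ := pick hb (fun y b => ∑ x, G x y (f x) b) q
    (fun y b => Finset.sum_nonneg fun x _ => hG _ _ _ _) hq β hβ
  have e1 : ∑ x, ∑ y, ∑ a, ∑ b, G x y a b * (p x a * q y b)
      = ∑ x, ∑ a, p x a * ∑ y, ∑ b, G x y a b * q y b := by
    refine Finset.sum_congr rfl fun x _ => ?_
    rw [Finset.sum_comm]
    simp only [Finset.mul_sum]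
    refine Finset.sum_congr rfl fun a _ => Finset.sum_congr rfl fun y _ =>
      Finset.sum_congr rfl fun b _ => by ring
  have e2 : ∑ x, ∑ y, ∑ b, G x y (f x) b * q y b
      = ∑ y, ∑ b, q y b * ∑ x, G x y (f x) b := by
    rw [Finset.sum_comm]
    refine Finset.sum_congr rfl fun y _ => ?_
    rw [Finset.sum_comm]
    simp only [Finset.mul_sum]
    refine Finset.sum_congr rfl fun b _ => Finset.sum_congr rfl fun x _ => by ring
  have e3 := cval_ge G f g
  rw [Finset.sum_comm] at e3
  rw [e1, mul_assoc]
  refine hf.trans (mul_le_mul_of_nonneg_left ?_ h0)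
  rw [e2]
  exact hg.trans (mul_le_mul_of_nonneg_left e3 h0')

lemma expand {d : ℕ} (ψ : Fin d × Fin d → ℂ) (A B : Matrix (Fin d) (Fin d) ℂ)
    (hA : A.PosSemidef) :
    ∑ p : Fin d × Fin d, ∑ q : Fin d × Fin d,
      (starRingEnd ℂ) (ψ p) * (A p.1 q.1 * B p.2 q.2) * ψ q
    = ∑ r : Fin d × Fin d, (starRingEnd ℂ) (A.mulVec (fun i => ψ (i, r.2)) r.1) *
        B.mulVec (fun j => ψ (r.1, j)) r.2 := by
  have hH : ∀ i j, (starRingEnd ℂ) (A i j) = A j i := fun i j => hA.1.apply j i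
  simp only [Matrix.mulVec, dotProduct, map_sum, map_mul, hH, Fintype.sum_prod_type,
    Finset.sum_mul, Finset.mul_sum]
  -- LHS: p1 p2 q1 q2 ; RHS: q1 p2 q2 p1 or similar
  have : ∀ F : Fin d → Fin d → Fin d → Fin d → ℂ,
      ∑ p1, ∑ p2, ∑ q1, ∑ q2, F p1 p2 q1 q2 = ∑ q1, ∑ p2, ∑ q2, ∑ p1, F p1 p2 q1 q2 := by
    intro F
    calc _ = ∑ p2, ∑ p1, ∑ q1, ∑ q2, F p1 p2 q1 q2 := Finset.sum_comm
      _ = ∑ p2, ∑ q1, ∑ p1, ∑ q2, F p1 p2 q1 q2 :=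
        Finset.sum_congr rfl fun _ _ => Finset.sum_comm
      _ = ∑ q1, ∑ p2, ∑ p1, ∑ q2, F p1 p2 q1 q2 := Finset.sum_comm
      _ = _ := Finset.sum_congr rfl fun _ _ => Finset.sum_congr rfl fun _ _ => Finset.sum_comm
  rw [this]
  refine Finset.sum_congr rfl fun q1 _ => Finset.sum_congr rfl fun p2 _ => ?_
  first
  | (refine Finset.sum_congr rfl fun _ _ => Finset.sum_congr rfl fun _ _ => by ring)
  | (rw [Finset.sum_comm]
     refine Finset.sum_congr rfl fun _ _ => Finset.sum_congr rfl fun _ _ => by ring)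

/-- there is a universal constant `K > 0` such that for every two-player game, `ω*(G) ≤ K √(|A||B|) ω(G)`. -/
theorem stmt13 :
    ∃ K : ℝ, 0 < K ∧
      ∀ {nx ny na nb : ℕ} (G : Fin nx → Fin ny → Fin na → Fin nb → ℝ),
        (∀ x y a b, 0 ≤ G x y a b) →
        (∑ x, ∑ y, ∑ a, ∑ b, G x y a b = 1) →
        gameQVal G ≤ K * Real.sqrt (na * nb) * gameCVal G := by
  refine ⟨1, one_pos, ?_⟩
  intro nx ny na nb G hG hsum
  have ha : 0 < na := by
    rcases Nat.eq_zero_or_pos na with h | h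
    · subst h; simp at hsum
    · exact h
  have hb : 0 < nb := by
    rcases Nat.eq_zero_or_pos nb with h | h
    · subst h; simp at hsum
    · exact h
  have hc : 0 ≤ gameCVal G :=
    le_trans (Finset.sum_nonneg fun x _ => Finset.sum_nonneg fun y _ => hG _ _ _ _)
      (cval_ge G (fun _ => ⟨0, ha⟩) (fun _ => ⟨0, hb⟩))
  rw [one_mul]
  refine Real.sSup_le ?_ (mul_nonneg (Real.sqrt_nonneg _) hc)
  rintro r ⟨d, ψ, A, B, -, hψ, hA, hA1, hB, hB1, rfl⟩
  set s : Fin nx → Fin na → ℝ := fun x a =>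
    ∑ r : Fin d × Fin d, ‖(A x a).mulVec (fun i => ψ (i, r.2)) r.1‖ ^ 2 with hs
  set t : Fin ny → Fin nb → ℝ := fun y b =>
    ∑ r : Fin d × Fin d, ‖(B y b).mulVec (fun j => ψ (r.1, j)) r.2‖ ^ 2 with ht
  have hs0 : ∀ x a, 0 ≤ s x a := fun x a => Finset.sum_nonneg fun _ _ => by positivity
  have ht0 : ∀ x a, 0 ≤ t x a := fun x a => Finset.sum_nonneg fun _ _ => by positivity
  have hs1 : ∀ x, ∑ a, s x a ≤ 1 := by
    intro x
    rw [← hψ]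
    simp only [hs, Fintype.sum_prod_type_right]
    rw [Finset.sum_comm]
    exact Finset.sum_le_sum fun j _ => povm_vec (A x) (hA x) (hA1 x) (fun i => ψ (i, j))
  have ht1 : ∀ y, ∑ b, t y b ≤ 1 := by
    intro y
    rw [← hψ]
    simp only [ht, Fintype.sum_prod_type]
    rw [Finset.sum_comm]
    exact Finset.sum_le_sum fun i _ => povm_vec (B y) (hB y) (hB1 y) (fun j => ψ (i, j))
  have hfr := frac ha hb G hG (fun x a => Real.sqrt (s x a)) (fun y b => Real.sqrt (t y b))
    (fun _ _ => Real.sqrt_nonneg _) (fun _ _ => Real.sqrt_nonneg _) (Real.sqrt na) (Real.sqrt nb)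
    (Real.sqrt_nonneg _) (Real.sqrt_nonneg _)
    (fun x => sum_sqrt_le _ (hs0 x) (hs1 x)) (fun y => sum_sqrt_le _ (ht0 y) (ht1 y))
  rw [Real.sqrt_mul (Nat.cast_nonneg _)]
  refine le_trans ?_ hfr
  simp only [Complex.re_sum]
  refine Finset.sum_le_sum fun x _ => Finset.sum_le_sum fun y _ =>
    Finset.sum_le_sum fun a _ => Finset.sum_le_sum fun b _ => ?_
  rw [Complex.re_ofReal_mul, expand ψ _ _ (hA x a)]
  exact mul_le_mul_of_nonneg_left (cs_fin _ _) (hG _ _ _ _)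
end

section
/- (Khot–Vishnoi games give near-linear violations in the number of outputs.) There exists a constant C > 0 such that for every integer ℓ ≥ 2, setting n = 2^ℓ, there exists a two-player game G with 2ⁿ/n inputs per player and n outputs per player satisfying ω*(G) ≥ C (n / log² n) · ω(G); moreover the entangled value lower bound is witnessed by a strategy using the maximally entangled state of local dimension n. -/
open scoped ComplexOrder

theorem kv_bern (r s : ℝ) (h0 : 0 ≤ r) (h1 : r ≤ 1) (hs : -1 < s) :
    1 + (r - 1) * s ≤ (1 + s) ^ (r - 1) := by
  have hb := rpow_one_add_le_one_add_mul_self (s := s) hs.le (p := 1 - r)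
    (by linarith) (by linarith)
  have hpos : 0 < (1 + s) ^ (1 - r) := Real.rpow_pos_of_pos (by linarith) _
  have e : (1 + s) ^ (r - 1) = ((1 + s) ^ (1 - r))⁻¹ := by
    rw [← Real.rpow_neg (by linarith)]; ring_nf
  rw [e, ← one_div, le_div_iff₀ hpos]
  rcases le_or_gt (1 + (r - 1) * s) 0 with h | h
  · nlinarith
  · nlinarith [mul_le_mul_of_nonneg_left hb h.le, sq_nonneg ((1 - r) * s)]

theorem kv_odd (r t : ℝ) (h0 : 0 ≤ r) (h1 : r ≤ 1) (ht0 : 0 ≤ t) (ht1 : t < 1) :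
    2 * r * t ≤ (1 + t) ^ r - (1 - t) ^ r := by
  have hd : ∀ x ∈ Set.Ioo (-1 : ℝ) 1, HasDerivAt (fun x : ℝ => (1 + x) ^ r - (1 - x) ^ r - 2 * r * x)
      (r * (1 + x) ^ (r - 1) + r * (1 - x) ^ (r - 1) - 2 * r) x := by
    intro x hx
    have a1 : HasDerivAt (fun x : ℝ => (1 + x) ^ r) (1 * r * (1 + x) ^ (r - 1)) x :=
      ((hasDerivAt_id' x).const_add 1).rpow_const (Or.inl (by linarith [hx.1]))
    have a2 : HasDerivAt (fun x : ℝ => (1 - x) ^ r) (-1 * r * (1 - x) ^ (r - 1)) x :=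
      ((hasDerivAt_id' x).const_sub 1).rpow_const (Or.inl (by linarith [hx.2]))
    have a3 : HasDerivAt (fun x : ℝ => 2 * r * x) (2 * r * 1) x :=
      (hasDerivAt_id' x).const_mul (2 * r)
    exact ((a1.sub a2).sub a3).congr_deriv (by ring)
  have hm : MonotoneOn (fun x : ℝ => (1 + x) ^ r - (1 - x) ^ r - 2 * r * x) (Set.Ico 0 1) := by
    apply monotoneOn_of_deriv_nonneg (convex_Ico 0 1)
    · intro x hx
      exact (hd x ⟨by linarith [hx.1], hx.2⟩).continuousAt.continuousWithinAt
    · intro x hx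
      rw [interior_Ico] at hx
      exact (hd x ⟨by linarith [hx.1], hx.2⟩).differentiableAt.differentiableWithinAt
    · intro x hx
      rw [interior_Ico] at hx
      rw [(hd x ⟨by linarith [hx.1], hx.2⟩).deriv]
      have b1 := kv_bern r x h0 h1 (by linarith [hx.1])
      have b2 := kv_bern r (-x) h0 h1 (by linarith [hx.2])
      rw [← sub_eq_add_neg] at b2
      nlinarith
  have := hm (a := 0) ⟨le_rfl, one_pos⟩ (b := t) ⟨ht0, ht1⟩ ht0
  simp at this
  linarith

theorem kv_even (r t : ℝ) (h0 : 0 ≤ r) (h1 : r ≤ 1) (ht0 : 0 ≤ t) (ht1 : t ≤ 1) :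
    2 + (1 + r) * r * t ^ 2 ≤ (1 + t) ^ (1 + r) + (1 - t) ^ (1 + r) := by
  have hd : ∀ x ∈ Set.Icc (-1 : ℝ) 1, HasDerivAt
      (fun x : ℝ => (1 + x) ^ (1 + r) + (1 - x) ^ (1 + r) - (1 + r) * r * x ^ 2)
      ((1 + r) * ((1 + x) ^ r - (1 - x) ^ r - 2 * r * x)) x := by
    intro x hx
    have a1 : HasDerivAt (fun x : ℝ => (1 + x) ^ (1 + r)) (1 * (1 + r) * (1 + x) ^ (1 + r - 1)) x :=
      ((hasDerivAt_id' x).const_add 1).rpow_const (Or.inr (by linarith))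
    have a2 : HasDerivAt (fun x : ℝ => (1 - x) ^ (1 + r)) (-1 * (1 + r) * (1 - x) ^ (1 + r - 1)) x :=
      ((hasDerivAt_id' x).const_sub 1).rpow_const (Or.inr (by linarith))
    have a3 : HasDerivAt (fun x : ℝ => (1 + r) * r * x ^ 2) ((1 + r) * r * (2 * x)) x := by
      simpa using (hasDerivAt_pow 2 x).const_mul ((1 + r) * r)
    have e : 1 + r - 1 = r := by ring
    rw [e] at a1 a2
    exact ((a1.add a2).sub a3).congr_deriv (by ring)
  have hm : MonotoneOn (fun x : ℝ => (1 + x) ^ (1 + r) + (1 - x) ^ (1 + r) - (1 + r) * r * x ^ 2)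
      (Set.Icc 0 1) := by
    apply monotoneOn_of_deriv_nonneg (convex_Icc 0 1)
    · intro x hx
      exact (hd x ⟨by linarith [hx.1], hx.2⟩).continuousAt.continuousWithinAt
    · intro x hx
      rw [interior_Icc] at hx
      exact (hd x ⟨by linarith [hx.1], hx.2.le⟩).differentiableAt.differentiableWithinAt
    · intro x hx
      rw [interior_Icc] at hx
      rw [(hd x ⟨by linarith [hx.1], hx.2.le⟩).deriv]
      have b1 := kv_odd r x h0 h1 hx.1.le hx.2
      exact mul_nonneg (by linarith) (by linarith)
  have := hm (a := 0) ⟨le_rfl, zero_le_one⟩ (b := t) ⟨ht0, ht1⟩ ht0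
  simp at this
  linarith

/-- Two-point hypercontractive inequality, `(p,2)` form, ordered. -/
theorem kv_two_aux (r a b : ℝ) (h0 : 0 ≤ r) (h1 : r ≤ 1) (hb : 0 ≤ b) (hab : b ≤ a) :
    Real.sqrt (((a + b) / 2) ^ 2 + r * ((a - b) / 2) ^ 2) ≤
      ((a ^ (1 + r) + b ^ (1 + r)) / 2) ^ (1 / (1 + r)) := by
  have hp : 0 < 1 + r := by linarith
  rcases eq_or_lt_of_le (show 0 ≤ a + b by linarith) with h | h
  · have ha : a = 0 := by linarith
    have hb' : b = 0 := by linarith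
    subst ha; subst hb'
    simp [hp.ne']
  set m := (a + b) / 2 with hm
  have hmp : 0 < m := by positivity
  set t := (a - b) / (a + b) with ht
  have ht0 : 0 ≤ t := div_nonneg (by linarith) h.le
  have ht1 : t ≤ 1 := by rw [ht, div_le_one h]; linarith
  have ea : a = m * (1 + t) := by rw [hm, ht]; field_simp; ring
  have eb : b = m * (1 - t) := by rw [hm, ht]; field_simp; ring
  have ed : (a - b) / 2 = m * t := by rw [hm, ht]; field_simp
  rw [ed]
  have e1 : (a ^ (1 + r) + b ^ (1 + r)) / 2
      = m ^ (1 + r) * (((1 + t) ^ (1 + r) + (1 - t) ^ (1 + r)) / 2) := by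
    rw [ea, eb, Real.mul_rpow hmp.le (by linarith), Real.mul_rpow hmp.le (by linarith)]; ring
  have hk := kv_even r t h0 h1 ht0 ht1
  have hz : 0 ≤ (1 + r) * r * t ^ 2 := by positivity
  rw [e1, Real.mul_rpow (by positivity) (by linarith), ← Real.rpow_mul hmp.le,
    mul_one_div_cancel hp.ne', Real.rpow_one]
  have e2 : m ^ 2 + r * (m * t) ^ 2 = m ^ 2 * (1 + r * t ^ 2) := by ring
  rw [e2, Real.sqrt_mul (by positivity), Real.sqrt_sq hmp.le]
  apply mul_le_mul_of_nonneg_left _ hmp.le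
  rw [one_div, Real.le_rpow_inv_iff_of_pos (Real.sqrt_nonneg _) (by linarith) hp,
    Real.sqrt_eq_rpow, ← Real.rpow_mul (by positivity)]
  have hq : 0 ≤ r * t ^ 2 := by positivity
  have := rpow_one_add_le_one_add_mul_self (s := r * t ^ 2) (by linarith)
    (p := 1 / 2 * (1 + r)) (by positivity) (by linarith)
  nlinarith

theorem kv_two (r a b : ℝ) (h0 : 0 ≤ r) (h1 : r ≤ 1) (ha : 0 ≤ a) (hb : 0 ≤ b) :
    Real.sqrt (((a + b) / 2) ^ 2 + r * ((a - b) / 2) ^ 2) ≤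
      ((a ^ (1 + r) + b ^ (1 + r)) / 2) ^ (1 / (1 + r)) := by
  rcases le_total b a with h | h
  · exact kv_two_aux r a b h0 h1 hb h
  · have := kv_two_aux r b a h0 h1 ha h
    rw [add_comm b a, add_comm (b ^ (1 + r))] at this
    convert this using 4
    ring

/-- Two-point two-function inequality. -/
theorem kv_point (r a b c d : ℝ) (h0 : 0 ≤ r) (h1 : r ≤ 1) (ha : 0 ≤ a) (hb : 0 ≤ b)
    (hc : 0 ≤ c) (hd : 0 ≤ d) :
    (1 + r) / 2 * (a * c) + (1 - r) / 2 * (a * d) + ((1 - r) / 2 * (b * c) + (1 + r) / 2 * (b * d))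
      ≤ (2 * (2⁻¹ : ℝ) ^ (1 / (1 + r)) * (2⁻¹ : ℝ) ^ (1 / (1 + r))) *
        ((a ^ (1 + r) + b ^ (1 + r)) ^ (1 / (1 + r)) *
          (c ^ (1 + r) + d ^ (1 + r)) ^ (1 / (1 + r))) := by
  have k1 := kv_two r a b h0 h1 ha hb
  have k2 := kv_two r c d h0 h1 hc hd
  have hpa := Real.rpow_nonneg ha (1 + r)
  have hpb := Real.rpow_nonneg hb (1 + r)
  have hpc := Real.rpow_nonneg hc (1 + r)
  have hpd := Real.rpow_nonneg hd (1 + r)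
  rw [div_eq_mul_inv (a ^ (1 + r) + b ^ (1 + r)), Real.mul_rpow (by linarith) (by norm_num)] at k1
  rw [div_eq_mul_inv (c ^ (1 + r) + d ^ (1 + r)), Real.mul_rpow (by linarith) (by norm_num)] at k2
  have cs : (a + b) / 2 * ((c + d) / 2) + r * ((a - b) / 2 * ((c - d) / 2)) ≤
      Real.sqrt (((a + b) / 2) ^ 2 + r * ((a - b) / 2) ^ 2) *
      Real.sqrt (((c + d) / 2) ^ 2 + r * ((c - d) / 2) ^ 2) := by
    rw [← Real.sqrt_mul (by positivity)]
    apply Real.le_sqrt_of_sq_le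
    nlinarith [mul_nonneg h0 (sq_nonneg ((a + b) / 2 * ((c - d) / 2) - (a - b) / 2 * ((c + d) / 2)))]
  have := cs.trans (mul_le_mul k1 k2 (Real.sqrt_nonneg _) (by positivity))
  nlinarith [this]

theorem kv_sum_two {M : Type*} [AddCommMonoid M] (F : ZMod 2 → M) : ∑ t, F t = F 0 + F 1 :=
  Fin.sum_univ_two F

theorem kv_sum_cons (n : ℕ) (F : (Fin (n + 1) → ZMod 2) → ℝ) :
    ∑ u, F u = ∑ u : Fin n → ZMod 2, F (Fin.cons 0 u) + ∑ u : Fin n → ZMod 2, F (Fin.cons 1 u) := by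
  rw [← (Fin.consEquiv (fun _ : Fin (n + 1) => ZMod 2)).sum_comp, Fintype.sum_prod_type, kv_sum_two]
  rfl

noncomputable def kvw (r : ℝ) (s t : ZMod 2) : ℝ := if s = t then (1 + r) / 2 else (1 - r) / 2

noncomputable def kvW {n : ℕ} (r : ℝ) (u v : Fin n → ZMod 2) : ℝ := ∏ i, kvw r (u i) (v i)

theorem kvW_cons {n : ℕ} (r : ℝ) (s t : ZMod 2) (u v : Fin n → ZMod 2) :
    kvW r (Fin.cons s u : Fin (n + 1) → ZMod 2) (Fin.cons t v : Fin (n + 1) → ZMod 2)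
      = kvw r s t * kvW r u v := by
  simp [kvW, Fin.prod_univ_succ]

theorem kvw_nonneg {r : ℝ} (h0 : 0 ≤ r) (h1 : r ≤ 1) (s t : ZMod 2) : 0 ≤ kvw r s t := by
  unfold kvw; split_ifs <;> linarith

theorem kvW_nonneg {n : ℕ} {r : ℝ} (h0 : 0 ≤ r) (h1 : r ≤ 1) (u v : Fin n → ZMod 2) :
    0 ≤ kvW r u v := Finset.prod_nonneg fun _ _ => kvw_nonneg h0 h1 _ _

noncomputable def kvN {n : ℕ} (r : ℝ) (f : (Fin n → ZMod 2) → ℝ) : ℝ :=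
  (∑ u, f u ^ (1 + r)) ^ (1 / (1 + r))

noncomputable def kvK (r : ℝ) : ℝ := 2 * (2⁻¹ : ℝ) ^ (1 / (1 + r)) * (2⁻¹ : ℝ) ^ (1 / (1 + r))

theorem kvN_nonneg {n : ℕ} (r : ℝ) (f : (Fin n → ZMod 2) → ℝ) (hf : ∀ u, 0 ≤ f u) :
    0 ≤ kvN r f := Real.rpow_nonneg (Finset.sum_nonneg fun u _ => Real.rpow_nonneg (hf u) _) _

theorem kvN_pow {n : ℕ} (r : ℝ) (h0 : 0 ≤ r) (f : (Fin n → ZMod 2) → ℝ) (hf : ∀ u, 0 ≤ f u) :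
    kvN r f ^ (1 + r) = ∑ u, f u ^ (1 + r) := by
  rw [kvN, ← Real.rpow_mul (Finset.sum_nonneg fun u _ => Real.rpow_nonneg (hf u) _),
    one_div_mul_cancel (by linarith), Real.rpow_one]

theorem kv_hyper (r : ℝ) (h0 : 0 ≤ r) (h1 : r ≤ 1) : ∀ (n : ℕ) (f g : (Fin n → ZMod 2) → ℝ),
    (∀ u, 0 ≤ f u) → (∀ u, 0 ≤ g u) →
    ∑ u, ∑ v, kvW r u v * (f u * g v) ≤ kvK r ^ n * (kvN r f * kvN r g) := by
  intro n
  induction n with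
  | zero =>
    intro f g hf hg
    have hp : (1 + r) ≠ 0 := by linarith
    simp only [kvN, kvW, Finset.univ_unique, Finset.sum_singleton, Finset.univ_eq_empty,
      Finset.prod_empty, pow_zero]
    rw [← Real.rpow_mul (hf _), ← Real.rpow_mul (hg _), mul_one_div_cancel hp, Real.rpow_one,
      Real.rpow_one]
  | succ n ih =>
    intro f g hf hg
    have key : ∀ s t : ZMod 2, ∑ u : Fin n → ZMod 2, ∑ v : Fin n → ZMod 2,
        kvW r (Fin.cons s u : Fin (n + 1) → ZMod 2) (Fin.cons t v : Fin (n + 1) → ZMod 2) *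
          (f (Fin.cons s u) * g (Fin.cons t v)) ≤
        kvw r s t * (kvK r ^ n * (kvN r (fun u => f (Fin.cons s u)) *
          kvN r (fun u => g (Fin.cons t u)))) := by
      intro s t
      have := mul_le_mul_of_nonneg_left (ih (fun u => f (Fin.cons s u)) (fun u => g (Fin.cons t u))
        (fun u => hf _) (fun u => hg _)) (kvw_nonneg h0 h1 s t)
      refine le_trans (le_of_eq ?_) this
      simp only [kvW_cons, Finset.mul_sum, mul_assoc]
    have hN : ∀ f : (Fin (n + 1) → ZMod 2) → ℝ, (∀ u, 0 ≤ f u) → kvN r f =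
        (kvN r (fun u : Fin n → ZMod 2 => f (Fin.cons 0 u)) ^ (1 + r) +
          kvN r (fun u : Fin n → ZMod 2 => f (Fin.cons 1 u)) ^ (1 + r)) ^ (1 / (1 + r)) := by
      intro f hf
      rw [kvN_pow r h0 _ (fun u => hf _), kvN_pow r h0 _ (fun u => hf _), kvN, kv_sum_cons]
    rw [kv_sum_cons]
    simp only [kv_sum_cons, Finset.sum_add_distrib]
    have hp := kv_point r _ _ _ _ h0 h1
      (kvN_nonneg r (fun u : Fin n → ZMod 2 => f (Fin.cons 0 u)) fun u => hf _)
      (kvN_nonneg r (fun u : Fin n → ZMod 2 => f (Fin.cons 1 u)) fun u => hf _)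
      (kvN_nonneg r (fun u : Fin n → ZMod 2 => g (Fin.cons 0 u)) fun u => hg _)
      (kvN_nonneg r (fun u : Fin n → ZMod 2 => g (Fin.cons 1 u)) fun u => hg _)
    rw [← hN f hf, ← hN g hg] at hp
    have hK : 0 ≤ kvK r := by unfold kvK; positivity
    have hp2 := mul_le_mul_of_nonneg_left hp (pow_nonneg hK n)
    have k00 := key 0 0
    have k01 := key 0 1
    have k10 := key 1 0
    have k11 := key 1 1
    have w00 : kvw r 0 0 = (1 + r) / 2 := by simp [kvw]
    have w11 : kvw r 1 1 = (1 + r) / 2 := by simp [kvw]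
    have w01 : kvw r 0 1 = (1 - r) / 2 := by simp [kvw]
    have w10 : kvw r 1 0 = (1 - r) / 2 := by simp [kvw]
    rw [w00] at k00
    rw [w01] at k01
    rw [w10] at k10
    rw [w11] at k11
    change _ ≤ kvK r ^ n * (kvK r * _) at hp2
    calc _ ≤ _ := add_le_add (add_le_add k00 k01) (add_le_add k10 k11)
      _ = _ := by ring
      _ ≤ _ := hp2
      _ = _ := by ring

/-- indicator version -/
theorem kv_indicator (n : ℕ) (r : ℝ) (h0 : 0 ≤ r) (h1 : r ≤ 1) (S T : Finset (Fin n → ZMod 2)) (M : ℝ)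
    (hM : 0 < M) (hS : (S.card : ℝ) = 2 ^ n / M) (hT : (T.card : ℝ) = 2 ^ n / M) :
    ∑ u ∈ S, ∑ v ∈ T, kvW r u v ≤ 2 ^ n * M ^ (-2 / (1 + r)) := by
  have hp : 0 < 1 + r := by linarith
  have h := kv_hyper r h0 h1 n (fun u => if u ∈ S then 1 else 0) (fun u => if u ∈ T then 1 else 0)
    (fun u => by split_ifs <;> simp) (fun u => by split_ifs <;> simp)
  have hn : ∀ S : Finset (Fin n → ZMod 2), (S.card : ℝ) = 2 ^ n / M →
      kvN r (fun u => if u ∈ S then 1 else 0) = (2 ^ n / M) ^ (1 / (1 + r)) := by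
    intro S hS
    rw [kvN, ← hS]
    congr 1
    simp [Real.zero_rpow hp.ne', apply_ite (fun x : ℝ => x ^ (1 + r))]
  rw [hn S hS, hn T hT] at h
  have e1 : ∑ u, ∑ v, kvW r u v * ((if u ∈ S then (1 : ℝ) else 0) * (if v ∈ T then 1 else 0))
      = ∑ u ∈ S, ∑ v ∈ T, kvW r u v := by
    simp [Finset.sum_ite_mem]
  rw [e1] at h
  refine h.trans (le_of_eq ?_)
  have e2 : (2⁻¹ : ℝ) ^ (1 / (1 + r)) = 2 ^ (-(1 / (1 + r))) := by
    rw [Real.inv_rpow (by norm_num), Real.rpow_neg (by norm_num)]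
  have e3 : kvK r = 2 ^ (1 - 2 / (1 + r)) := by
    rw [kvK, e2, mul_assoc, ← Real.rpow_add (by norm_num), Real.rpow_sub (by norm_num), Real.rpow_one,
      div_eq_mul_inv (2 : ℝ), ← Real.rpow_neg (by norm_num)]
    congr 2; ring
  rw [e3, ← Real.rpow_add (by positivity), Real.div_rpow (by positivity) hM.le,
    ← Real.rpow_natCast (2 ^ (1 - 2 / (1 + r))), ← Real.rpow_mul (by norm_num),
    ← Real.rpow_natCast 2 n, ← Real.rpow_mul (by norm_num), div_eq_mul_inv _ (M ^ _), ← Real.rpow_neg hM.le,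
    ← mul_assoc, ← Real.rpow_add (by norm_num)]
  congr 1
  · congr 1; field_simp; ring
  · congr 1; field_simp; ring

def kvchi (s : ZMod 2) : ℝ := if s = 0 then 1 else -1

theorem kv_cases (s : ZMod 2) : s = 0 ∨ s = 1 := by
  revert s; decide

theorem kvchi_add (s t : ZMod 2) : kvchi (s + t) = kvchi s * kvchi t := by
  rcases kv_cases s with rfl | rfl <;> rcases kv_cases t with rfl | rfl <;>
    simp [kvchi, show (1 : ZMod 2) + 1 = 0 from rfl]

theorem kvchi_zero : kvchi 0 = 1 := by simp [kvchi]

theorem kvchi_one : kvchi 1 = -1 := by simp [kvchi]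

theorem kvchi_sum {ι : Type*} (s : Finset ι) (F : ι → ZMod 2) :
    kvchi (∑ i ∈ s, F i) = ∏ i ∈ s, kvchi (F i) := by
  classical
  induction s using Finset.induction_on with
  | empty => simp [kvchi]
  | insert a s ha ih => rw [Finset.sum_insert ha, Finset.prod_insert ha, kvchi_add, ih]

theorem kvchi_mul_self (s : ZMod 2) : kvchi s * kvchi s = 1 := by
  unfold kvchi; split_ifs <;> norm_num

theorem kvchi_sub (s t : ZMod 2) : kvchi (s - t) = kvchi s * kvchi t := by
  rw [← kvchi_add, ZModModule.sub_eq_add]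

theorem kv_char_sum (l : ℕ) (k : Fin l → ZMod 2) (hk : k ≠ 0) :
    ∑ y : Fin l → ZMod 2, kvchi (∑ j, k j * y j) = 0 := by
  obtain ⟨j, hj⟩ := Function.ne_iff.mp hk
  simp only [kvchi_sum]
  rw [← Fintype.prod_sum (fun j t => kvchi (k j * t))]
  apply Finset.prod_eq_zero (Finset.mem_univ j)
  have : k j = 1 := (kv_cases _).resolve_left hj
  rw [kv_sum_two, this]
  simp [kvchi]

/-- Coset enumeration with Hadamard orthogonality. -/
theorem kv_enum (l n : ℕ) (hn : n = 2 ^ l) :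
    ∃ e : Fin (2 ^ n / n) × Fin n ≃ (Fin n → ZMod 2),
      ∀ x a b, a ≠ b → ∑ i, kvchi (e (x, a) i) * kvchi (e (x, b) i) = 0 := by
  classical
  have hn0 : 0 < n := by rw [hn]; positivity
  have hc : Fintype.card (Fin l → ZMod 2) = n := by simp [hn, ZMod.card]
  let φ : Fin n ≃ (Fin l → ZMod 2) := (Fintype.equivFinOfCardEq hc).symm
  let h : (Fin l → ZMod 2) →+ (Fin n → ZMod 2) :=
    { toFun := fun k i => ∑ j, k j * φ i j
      map_zero' := by ext i; simp
      map_add' := by intro k k'; ext i; simp [add_mul, Finset.sum_add_distrib] }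
  have hsum : ∀ k, k ≠ 0 → ∑ i, kvchi (h k i) = 0 := by
    intro k hk
    rw [← kv_char_sum l k hk, ← φ.sum_comp]
    rfl
  have hinj : Function.Injective h := by
    rw [injective_iff_map_eq_zero]
    intro k hk
    by_contra hne
    have := hsum k hne
    rw [hk] at this
    simp [kvchi] at this
    omega
  have hcr : Nat.card h.range = n := by
    rw [← Nat.card_congr (AddMonoidHom.ofInjective hinj).toEquiv, Nat.card_eq_fintype_card, hc]
  have hcq : Nat.card ((Fin n → ZMod 2) ⧸ h.range) = 2 ^ n / n := by
    have := h.range.card_eq_card_quotient_mul_card_addSubgroup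
    rw [hcr, Nat.card_eq_fintype_card] at this
    simp only [Fintype.card_fun, ZMod.card, Fintype.card_fin] at this
    rw [this, Nat.mul_div_cancel _ hn0]
  let e1 : Fin (2 ^ n / n) ≃ ((Fin n → ZMod 2) ⧸ h.range) :=
    (finCongr hcq.symm).trans (Finite.equivFin _).symm
  let e2 : Fin n ≃ h.range := (finCongr hcr.symm).trans (Finite.equivFin _).symm
  let e := (Equiv.prodCongr e1 e2).trans
    (AddSubgroup.addGroupEquivQuotientProdAddSubgroup (s := h.range)).symm
  refine ⟨e, ?_⟩
  intro x a b hab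
  have hq : ∀ a, ((e (x, a) : Fin n → ZMod 2) : (Fin n → ZMod 2) ⧸ h.range) = e1 x := by
    intro a
    have : (AddSubgroup.addGroupEquivQuotientProdAddSubgroup (s := h.range) (e (x, a))).1 = e1 x := by
      simp [e]
    exact this
  have hmem : e (x, a) - e (x, b) ∈ h.range := by
    have := (hq b).trans (hq a).symm
    rw [QuotientAddGroup.eq] at this
    rwa [sub_eq_neg_add]
  obtain ⟨k, hk⟩ := hmem
  have hk0 : k ≠ 0 := by
    rintro rfl
    rw [map_zero] at hk
    have := e.injective (sub_eq_zero.mp hk.symm)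
    simp at this
    exact hab this
  rw [← hsum k hk0]
  apply Finset.sum_congr rfl
  intro i _
  rw [hk, Pi.sub_apply, kvchi_sub]

theorem kvw_sum (r : ℝ) (s : ZMod 2) : ∑ t, kvw r s t = 1 := by
  rw [kv_sum_two]
  rcases kv_cases s with rfl | rfl <;> simp [kvw] <;> ring

theorem kvw_sum_chi (r : ℝ) (s : ZMod 2) : ∑ t, kvw r s t * (kvchi s * kvchi t) = r := by
  rw [kv_sum_two]
  rcases kv_cases s with rfl | rfl <;> simp [kvw, kvchi] <;> ring

theorem kvW_sum {n : ℕ} (r : ℝ) (u : Fin n → ZMod 2) : ∑ v, kvW r u v = 1 := by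
  unfold kvW
  rw [← Fintype.prod_sum (fun i t => kvw r (u i) t)]
  simp [kvw_sum]

theorem kvW_sum_chi {n : ℕ} (r : ℝ) (u : Fin n → ZMod 2) (i : Fin n) :
    ∑ v, kvW r u v * (kvchi (u i) * kvchi (v i)) = r := by
  classical
  have : ∀ v : Fin n → ZMod 2, kvW r u v * (kvchi (u i) * kvchi (v i)) =
      ∏ j, kvw r (u j) (v j) * (if j = i then kvchi (u j) * kvchi (v j) else 1) := by
    intro v
    rw [Finset.prod_mul_distrib, Finset.prod_ite_eq' Finset.univ i]
    simp [kvW]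
  simp only [this]
  rw [← Fintype.prod_sum (fun j t => kvw r (u j) t * (if j = i then kvchi (u j) * kvchi t else 1))]
  rw [Finset.prod_eq_single i]
  · simp [kvw_sum_chi]
  · intro j _ hj
    simp [hj, kvw_sum]
  · simp

theorem kvW_second {n : ℕ} (r : ℝ) (h0 : 0 ≤ r) (h1 : r ≤ 1) (u : Fin n → ZMod 2) :
    ((n : ℝ) * r) ^ 2 ≤ ∑ v, kvW r u v * (∑ i, kvchi (u i) * kvchi (v i)) ^ 2 := by
  have m1 : ∑ v, kvW r u v * (∑ i, kvchi (u i) * kvchi (v i)) = n * r := by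
    simp only [Finset.mul_sum]
    rw [Finset.sum_comm]
    simp [kvW_sum_chi]
  have hnn : 0 ≤ ∑ v, kvW r u v * ((∑ i, kvchi (u i) * kvchi (v i)) - n * r) ^ 2 :=
    Finset.sum_nonneg fun v _ => mul_nonneg (kvW_nonneg h0 h1 _ _) (sq_nonneg _)
  have e : ∑ v, kvW r u v * ((∑ i, kvchi (u i) * kvchi (v i)) - n * r) ^ 2 =
      ∑ v, kvW r u v * (∑ i, kvchi (u i) * kvchi (v i)) ^ 2
        - 2 * (n * r) * ∑ v, kvW r u v * (∑ i, kvchi (u i) * kvchi (v i))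
        + (n * r) ^ 2 * ∑ v, kvW r u v := by
    rw [Finset.mul_sum, Finset.mul_sum, ← Finset.sum_sub_distrib, ← Finset.sum_add_distrib]
    exact Finset.sum_congr rfl fun v _ => by ring
  rw [e, m1, kvW_sum] at hnn
  nlinarith

open scoped Kronecker in
theorem kv_term {d : ℕ} (ψ : Fin d × Fin d → ℂ) (A B : Matrix (Fin d) (Fin d) ℂ) :
    ∑ p : Fin d × Fin d, ∑ q : Fin d × Fin d,
      (starRingEnd ℂ) (ψ p) * (A p.1 q.1 * B p.2 q.2) * ψ q
      = dotProduct (star ψ) (Matrix.mulVec (A ⊗ₖ B) ψ) := by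
  simp only [dotProduct, Matrix.mulVec, Finset.mul_sum, Matrix.kroneckerMap_apply, Pi.star_apply,
    mul_assoc]
  rfl

theorem kv_term_nonneg {d : ℕ} (ψ : Fin d × Fin d → ℂ) (A B : Matrix (Fin d) (Fin d) ℂ)
    (hA : A.PosSemidef) (hB : B.PosSemidef) :
    0 ≤ (∑ p : Fin d × Fin d, ∑ q : Fin d × Fin d,
      (starRingEnd ℂ) (ψ p) * (A p.1 q.1 * B p.2 q.2) * ψ q).re := by
  rw [kv_term]
  exact (hA.kronecker hB).re_dotProduct_nonneg ψ

theorem kv_term_sum {d m k : ℕ} (ψ : Fin d × Fin d → ℂ) (hψ : ∑ p, ‖ψ p‖ ^ 2 = 1)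
    (A : Fin m → Matrix (Fin d) (Fin d) ℂ) (B : Fin k → Matrix (Fin d) (Fin d) ℂ)
    (hA : ∑ a, A a = 1) (hB : ∑ b, B b = 1) :
    ∑ a, ∑ b, (∑ p : Fin d × Fin d, ∑ q : Fin d × Fin d,
      (starRingEnd ℂ) (ψ p) * (A a p.1 q.1 * B b p.2 q.2) * ψ q).re = 1 := by
  have hA' : ∀ i j, ∑ a, A a i j = (1 : Matrix (Fin d) (Fin d) ℂ) i j := by
    intro i j; rw [← hA, Matrix.sum_apply]
  have hB' : ∀ i j, ∑ b, B b i j = (1 : Matrix (Fin d) (Fin d) ℂ) i j := by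
    intro i j; rw [← hB, Matrix.sum_apply]
  simp only [← Complex.re_sum]
  have e : ∑ a, ∑ b, ∑ p : Fin d × Fin d, ∑ q : Fin d × Fin d,
      (starRingEnd ℂ) (ψ p) * (A a p.1 q.1 * B b p.2 q.2) * ψ q =
      ∑ p : Fin d × Fin d, ∑ q : Fin d × Fin d,
      (starRingEnd ℂ) (ψ p) * ((∑ a, A a p.1 q.1) * (∑ b, B b p.2 q.2)) * ψ q := by
    simp only [Finset.sum_mul_sum]
    simp only [Finset.mul_sum, Finset.sum_mul]
    have h1 : ∀ a, ∑ b, ∑ p : Fin d × Fin d, ∑ q : Fin d × Fin d,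
      (starRingEnd ℂ) (ψ p) * (A a p.1 q.1 * B b p.2 q.2) * ψ q =
      ∑ p : Fin d × Fin d, ∑ q : Fin d × Fin d, ∑ b,
      (starRingEnd ℂ) (ψ p) * (A a p.1 q.1 * B b p.2 q.2) * ψ q := by
      intro a
      rw [Finset.sum_comm]
      exact Finset.sum_congr rfl fun p _ => Finset.sum_comm
    simp only [h1]
    rw [Finset.sum_comm]
    exact Finset.sum_congr rfl fun p _ => Finset.sum_comm
  rw [e]
  simp only [hA', hB']
  have e2 : ∀ p q : Fin d × Fin d, (starRingEnd ℂ) (ψ p) *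
      ((1 : Matrix (Fin d) (Fin d) ℂ) p.1 q.1 * (1 : Matrix (Fin d) (Fin d) ℂ) p.2 q.2) * ψ q =
      if p = q then ((‖ψ p‖ ^ 2 : ℝ) : ℂ) else 0 := by
    intro p q
    by_cases hpq : p = q
    · subst hpq
      simp only [Matrix.one_apply_eq, mul_one, if_true]
      rw [Complex.conj_mul']; push_cast; rfl
    · rw [if_neg hpq]
      by_cases h1 : p.1 = q.1
      · have h2 : p.2 ≠ q.2 := fun h2 => hpq (Prod.ext h1 h2)
        simp [Matrix.one_apply_ne h2]
      · simp [Matrix.one_apply_ne h1]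
  simp only [e2, Finset.sum_ite_eq, Finset.mem_univ, if_true]
  rw [← Complex.ofReal_sum, hψ]
  simp

theorem kv_le_qval {nx ny na nb : ℕ} (G : Fin nx → Fin ny → Fin na → Fin nb → ℝ)
    (hG : ∀ x y a b, 0 ≤ G x y a b) (d : ℕ) (ψ : Fin d × Fin d → ℂ)
    (A : Fin nx → Fin na → Matrix (Fin d) (Fin d) ℂ)
    (B : Fin ny → Fin nb → Matrix (Fin d) (Fin d) ℂ)
    (hd : 1 ≤ d) (hψ : ∑ p, ‖ψ p‖ ^ 2 = 1)
    (hA : ∀ x a, (A x a).PosSemidef) (hA1 : ∀ x, ∑ a, A x a = 1)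
    (hB : ∀ y b, (B y b).PosSemidef) (hB1 : ∀ y, ∑ b, B y b = 1) :
    (∑ x, ∑ y, ∑ a, ∑ b, (G x y a b : ℂ) *
          ∑ p : Fin d × Fin d, ∑ q : Fin d × Fin d,
            (starRingEnd ℂ) (ψ p) * (A x a p.1 q.1 * B y b p.2 q.2) * ψ q).re ≤ gameQVal G := by
  unfold gameQVal
  apply le_csSup
  · refine ⟨∑ x, ∑ y, ∑ a, ∑ b, G x y a b, ?_⟩
    rintro _ ⟨d, ψ, A, B, hd, hψ, hA, hA1, hB, hB1, rfl⟩
    simp only [Complex.re_sum]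
    refine Finset.sum_le_sum fun x _ => Finset.sum_le_sum fun y _ => Finset.sum_le_sum fun a _ =>
      Finset.sum_le_sum fun b _ => ?_
    rw [Complex.re_ofReal_mul]
    refine mul_le_of_le_one_right (hG _ _ _ _) ?_
    rw [← kv_term_sum ψ hψ (A x) (B y) (hA1 x) (hB1 y)]
    have hn : ∀ a b, 0 ≤ (∑ p : Fin d × Fin d, ∑ q : Fin d × Fin d,
      (starRingEnd ℂ) (ψ p) * (A x a p.1 q.1 * B y b p.2 q.2) * ψ q).re := fun a b =>
      kv_term_nonneg ψ _ _ (hA x a) (hB y b)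
    refine le_trans ?_ (Finset.single_le_sum (f := fun a => ∑ b, (∑ p : Fin d × Fin d,
      ∑ q : Fin d × Fin d, (starRingEnd ℂ) (ψ p) * (A x a p.1 q.1 * B y b p.2 q.2) * ψ q).re)
      (fun a _ => Finset.sum_nonneg fun b _ => hn a b) (Finset.mem_univ a))
    exact Finset.single_le_sum (f := fun b => (∑ p : Fin d × Fin d,
      ∑ q : Fin d × Fin d, (starRingEnd ℂ) (ψ p) * (A x a p.1 q.1 * B y b p.2 q.2) * ψ q).re)
      (fun b _ => hn a b) (Finset.mem_univ b)
  · exact ⟨d, ψ, A, B, hd, hψ, hA, hA1, hB, hB1, rfl⟩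

noncomputable def kvP {n : ℕ} (u : Fin n → ZMod 2) : Matrix (Fin n) (Fin n) ℂ :=
  fun i j => (((n : ℝ)⁻¹ * (kvchi (u i) * kvchi (u j)) : ℝ) : ℂ)

theorem kvP_psd {n : ℕ} (u : Fin n → ZMod 2) : (kvP u).PosSemidef := by
  have h := Matrix.posSemidef_vecMulVec_self_star
    (fun i => (((Real.sqrt n)⁻¹ * kvchi (u i) : ℝ) : ℂ))
  convert h using 1
  ext i j
  simp only [kvP, Matrix.vecMulVec_apply, Pi.star_apply, RCLike.star_def, Complex.conj_ofReal]
  rw [← Complex.ofReal_mul]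
  congr 1
  have : (n : ℝ)⁻¹ = (Real.sqrt n)⁻¹ * (Real.sqrt n)⁻¹ := by
    rw [← mul_inv, Real.mul_self_sqrt (by positivity)]
  rw [this]; ring

theorem kvP_sum {n : ℕ} (hn : 0 < n) (c : Fin n → Fin n → ZMod 2)
    (hc : ∀ a b, a ≠ b → ∑ i, kvchi (c a i) * kvchi (c b i) = 0) :
    ∑ a, kvP (c a) = 1 := by
  have hn' : (n : ℝ) ≠ 0 := by positivity
  obtain ⟨M, hM⟩ : ∃ M : Matrix (Fin n) (Fin n) ℝ, ∀ a i, M a i = kvchi (c a i) :=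
    ⟨Matrix.of fun a i => kvchi (c a i), fun _ _ => rfl⟩
  have h1 : M * ((n : ℝ)⁻¹ • M.transpose) = 1 := by
    ext a b
    simp only [Matrix.smul_apply, Matrix.mul_apply, Matrix.transpose_apply, hM,
      smul_eq_mul, mul_left_comm _ ((n : ℝ)⁻¹)]
    rw [← Finset.mul_sum]
    by_cases hab : a = b
    · subst hab
      simp [kvchi_mul_self, hn']
    · rw [hc a b hab, Matrix.one_apply_ne hab, mul_zero]
  have h2 := mul_eq_one_comm.mp h1
  ext i j
  rw [Matrix.sum_apply]
  have h3 := congrFun (congrFun h2 i) j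
  simp only [Matrix.smul_apply, Matrix.mul_apply, Matrix.transpose_apply, hM,
      smul_eq_mul, mul_assoc] at h3
  simp only [kvP]
  rw [← Complex.ofReal_sum, h3]
  by_cases hij : i = j
  · subst hij; simp
  · simp [Matrix.one_apply_ne hij]

theorem kvP_term {n : ℕ} (u v : Fin n → ZMod 2) :
    ∑ p : Fin n × Fin n, ∑ q : Fin n × Fin n,
      (starRingEnd ℂ) (if p.1 = p.2 then (((Real.sqrt n)⁻¹ : ℝ) : ℂ) else 0) *
        (kvP u p.1 q.1 * kvP v p.2 q.2) *
        (if q.1 = q.2 then (((Real.sqrt n)⁻¹ : ℝ) : ℂ) else 0)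
      = (((n : ℝ)⁻¹ ^ 3 * (∑ i, kvchi (u i) * kvchi (v i)) ^ 2 : ℝ) : ℂ) := by
  have hs : (n : ℝ)⁻¹ = (Real.sqrt n)⁻¹ * (Real.sqrt n)⁻¹ := by
    rw [← mul_inv, Real.mul_self_sqrt (by positivity)]
  simp only [Fintype.sum_prod_type, apply_ite (starRingEnd ℂ), map_zero, ite_mul, mul_ite, zero_mul,
    mul_zero, Finset.sum_ite_eq, Finset.mem_univ, if_true, Complex.conj_ofReal,
    Finset.sum_const_zero, Finset.sum_ite_irrel]
  simp only [kvP, ← Complex.ofReal_mul, ← Complex.ofReal_sum]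
  congr 1
  rw [sq, Finset.sum_mul_sum, Finset.mul_sum]
  refine Finset.sum_congr rfl fun i _ => ?_
  rw [Finset.mul_sum]
  refine Finset.sum_congr rfl fun j _ => ?_
  rw [show (n : ℝ)⁻¹ ^ 3 = ((Real.sqrt n)⁻¹ * (Real.sqrt n)⁻¹) * (n : ℝ)⁻¹ ^ 2 by rw [← hs]; ring]
  ring

theorem kv_sum_enum {n N : ℕ} (e : Fin N × Fin n ≃ (Fin n → ZMod 2))
    (F : (Fin n → ZMod 2) → (Fin n → ZMod 2) → ℝ) :
    ∑ x, ∑ y, ∑ a, ∑ b, F (e (x, a)) (e (y, b)) = ∑ u, ∑ v, F u v := by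
  rw [← e.sum_comp, Fintype.sum_prod_type]
  refine Finset.sum_congr rfl fun x _ => ?_
  rw [Finset.sum_comm]
  refine Finset.sum_congr rfl fun a _ => ?_
  rw [← e.sum_comp, Fintype.sum_prod_type]

/-- Khot–Vishnoi games give near-linear violations in the number of
outputs: there is `C > 0` such that for every `ℓ ≥ 2`, with `n = 2^ℓ`, there is a
two-player game with `2ⁿ/n` inputs and `n` outputs per player whose entangled value is
at least `C (n / log² n)` times its classical value; moreover this is witnessed by a
strategy using the maximally entangled state of local dimension `n`. -/
theorem stmt14 :
    ∃ C : ℝ, 0 < C ∧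
      ∀ ℓ : ℕ, 2 ≤ ℓ →
        ∀ n : ℕ, n = 2 ^ ℓ →
          ∃ G : Fin (2 ^ n / n) → Fin (2 ^ n / n) → Fin n → Fin n → ℝ,
            (∀ x y a b, 0 ≤ G x y a b) ∧
            (∑ x, ∑ y, ∑ a, ∑ b, G x y a b = 1) ∧
            C * (n / Real.log n ^ 2) * gameCVal G ≤ gameQVal G ∧
            ∃ (A : Fin (2 ^ n / n) → Fin n → Matrix (Fin n) (Fin n) ℂ)
              (B : Fin (2 ^ n / n) → Fin n → Matrix (Fin n) (Fin n) ℂ),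
              (∀ x a, (A x a).PosSemidef) ∧ (∀ x, ∑ a, A x a = 1) ∧
              (∀ y b, (B y b).PosSemidef) ∧ (∀ y, ∑ b, B y b = 1) ∧
              C * (n / Real.log n ^ 2) * gameCVal G ≤
                (∑ x, ∑ y, ∑ a, ∑ b, (G x y a b : ℂ) *
                  ∑ p : Fin n × Fin n, ∑ q : Fin n × Fin n,
                    (starRingEnd ℂ)
                        (if p.1 = p.2 then (((Real.sqrt n)⁻¹ : ℝ) : ℂ) else 0) *
                      (A x a p.1 q.1 * B y b p.2 q.2) *
                      (if q.1 = q.2 then (((Real.sqrt n)⁻¹ : ℝ) : ℂ) else 0)).re := by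
  refine ⟨Real.log 2 ^ 2 / 4, by have := Real.log_pos one_lt_two; positivity, ?_⟩
  intro l hl n hn
  have hn0 : 0 < n := by rw [hn]; positivity
  have hnR : (0 : ℝ) < n := by exact_mod_cast hn0
  have hlR : (2 : ℝ) ≤ l := by exact_mod_cast hl
  have hl0 : (0 : ℝ) < l := by linarith
  have hdvd : n ∣ 2 ^ n := by
    rw [hn]; exact pow_dvd_pow 2 (Nat.lt_two_pow_self).le
  obtain ⟨e, he⟩ := kv_enum l n hn
  set r : ℝ := 1 / l with hr
  have h0 : 0 ≤ r := by positivity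
  have h1 : r ≤ 1 := by rw [hr, div_le_one hl0]; linarith
  let G : Fin (2 ^ n / n) → Fin (2 ^ n / n) → Fin n → Fin n → ℝ :=
    fun x y a b => ((2 : ℝ) ^ n)⁻¹ * kvW r (e (x, a)) (e (y, b))
  have hG : ∀ x y a b, 0 ≤ G x y a b := fun x y a b =>
    mul_nonneg (by positivity) (kvW_nonneg h0 h1 _ _)
  have hcard : (Fintype.card (Fin n → ZMod 2) : ℝ) = 2 ^ n := by simp [ZMod.card]
  have hG1 : ∑ x, ∑ y, ∑ a, ∑ b, G x y a b = 1 := by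
    rw [kv_sum_enum e (fun u v => ((2 : ℝ) ^ n)⁻¹ * kvW r u v)]
    simp only [← Finset.mul_sum, kvW_sum]
    rw [Finset.sum_const, Finset.card_univ, nsmul_eq_mul, hcard]
    field_simp
  have hC : gameCVal G ≤ 4 / (n : ℝ) ^ 2 := by
    have hne : Nonempty (Fin n) := ⟨⟨0, hn0⟩⟩
    obtain ⟨a0⟩ := hne
    unfold gameCVal
    refine csSup_le ⟨_, ⟨fun _ => a0, fun _ => a0, rfl⟩⟩ ?_
    rintro _ ⟨f, g, rfl⟩
    have hinj : ∀ f : Fin (2 ^ n / n) → Fin n, Function.Injective (fun x => e (x, f x)) := by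
      intro f x y hxy
      have := e.injective hxy
      exact (Prod.ext_iff.mp this).1
    have hcS : ∀ f : Fin (2 ^ n / n) → Fin n,
        (((Finset.univ.map ⟨_, hinj f⟩).card : ℕ) : ℝ) = 2 ^ n / n := by
      intro f
      rw [Finset.card_map, Finset.card_univ, Fintype.card_fin, Nat.cast_div hdvd hnR.ne']
      push_cast; rfl
    have hk := kv_indicator n r h0 h1 _ _ n hnR (hcS f) (hcS g)
    simp only [Finset.sum_map, Function.Embedding.coeFn_mk] at hk
    simp only [G, ← Finset.mul_sum]
    rw [inv_mul_le_iff₀ (by positivity)]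
    refine hk.trans ?_
    apply mul_le_mul_of_nonneg_left _ (by positivity)
    have hn1 : (1 : ℝ) ≤ n := by exact_mod_cast hn0
    have hexp : -2 / (1 + r) ≤ -2 + 2 * r := by
      rw [div_le_iff₀ (by linarith)]; nlinarith
    refine (Real.rpow_le_rpow_of_exponent_le hn1 hexp).trans (le_of_eq ?_)
    rw [Real.rpow_add hnR]
    have e1 : (n : ℝ) ^ (2 * r) = 4 := by
      rw [hn]; push_cast
      rw [← Real.rpow_natCast, ← Real.rpow_mul (by norm_num), hr]
      have : (l : ℝ) * (2 * (1 / l)) = (2 : ℕ) := by field_simp; norm_num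
      rw [this, Real.rpow_natCast]; norm_num
    have e2 : (n : ℝ) ^ (-2 : ℝ) = ((n : ℝ) ^ 2)⁻¹ := by
      rw [Real.rpow_neg hnR.le]; norm_cast
    rw [e1, e2]; field_simp
  have hlog : Real.log n = l * Real.log 2 := by
    rw [hn]; push_cast; rw [Real.log_pow]
  have hbound : Real.log 2 ^ 2 / 4 * (n / Real.log n ^ 2) * gameCVal G ≤ r ^ 2 / n := by
    have hl2 := Real.log_pos one_lt_two
    refine (mul_le_mul_of_nonneg_left hC (by positivity)).trans (le_of_eq ?_)
    rw [hlog, hr]; field_simp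
  have hval : r ^ 2 / n ≤ (∑ x, ∑ y, ∑ a, ∑ b, (G x y a b : ℂ) *
                  ∑ p : Fin n × Fin n, ∑ q : Fin n × Fin n,
                    (starRingEnd ℂ)
                        (if p.1 = p.2 then (((Real.sqrt n)⁻¹ : ℝ) : ℂ) else 0) *
                      (kvP (e (x, a)) p.1 q.1 * kvP (e (y, b)) p.2 q.2) *
                      (if q.1 = q.2 then (((Real.sqrt n)⁻¹ : ℝ) : ℂ) else 0)).re := by
    simp only [kvP_term, ← Complex.ofReal_mul, ← Complex.ofReal_sum, Complex.ofReal_re]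
    simp only [G]
    rw [kv_sum_enum e (fun u v => ((2 : ℝ) ^ n)⁻¹ * kvW r u v *
      ((n : ℝ)⁻¹ ^ 3 * (∑ i, kvchi (u i) * kvchi (v i)) ^ 2))]
    have hu : ∀ u : Fin n → ZMod 2, ((2 : ℝ) ^ n)⁻¹ * (n : ℝ)⁻¹ ^ 3 * ((n : ℝ) * r) ^ 2 ≤
        ∑ v, ((2 : ℝ) ^ n)⁻¹ * kvW r u v *
          ((n : ℝ)⁻¹ ^ 3 * (∑ i, kvchi (u i) * kvchi (v i)) ^ 2) := by
      intro u
      refine (mul_le_mul_of_nonneg_left (kvW_second r h0 h1 u) (by positivity)).trans (le_of_eq ?_)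
      rw [Finset.mul_sum]
      exact Finset.sum_congr rfl fun v _ => by ring
    refine le_trans (le_of_eq ?_) (Finset.sum_le_sum fun u _ => hu u)
    rw [Finset.sum_const, Finset.card_univ, nsmul_eq_mul, hcard]
    field_simp
  have hψ : ∑ p : Fin n × Fin n, ‖(if p.1 = p.2 then (((Real.sqrt n)⁻¹ : ℝ) : ℂ) else 0)‖ ^ 2 = 1 := by
    have : ∀ p : Fin n × Fin n, ‖(if p.1 = p.2 then (((Real.sqrt n)⁻¹ : ℝ) : ℂ) else 0)‖ ^ 2 =
        if p.1 = p.2 then (n : ℝ)⁻¹ else 0 := by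
      intro p
      split_ifs
      · rw [Complex.norm_real, Real.norm_eq_abs, sq_abs, inv_pow, Real.sq_sqrt hnR.le]
      · simp
    simp only [this, Fintype.sum_prod_type]
    simp [hnR.ne']
  have hA1 : ∀ x, ∑ a, kvP (e (x, a)) = 1 := fun x => kvP_sum hn0 _ (he x)
  refine ⟨G, hG, hG1, ?_, fun x a => kvP (e (x, a)), fun x a => kvP (e (x, a)),
    fun x a => kvP_psd _, hA1, fun x a => kvP_psd _, hA1, hbound.trans hval⟩
  refine (hbound.trans hval).trans ?_
  exact kv_le_qval G hG n (fun p => if p.1 = p.2 then (((Real.sqrt n)⁻¹ : ℝ) : ℂ) else 0)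
    (fun x a => kvP (e (x, a))) (fun x a => kvP (e (x, a))) hn0 hψ
    (fun x a => kvP_psd _) hA1 (fun x a => kvP_psd _) hA1
end

section
/- (Near-optimal XOR strategies in bounded dimension.) For every real matrix G ∈ ℝ^{n×m} and every ε ∈ (0,1), setting D = 2^{⌊2/ε²⌋}, the entangled bias restricted to local dimension D satisfies β*_D(G) ≥ (1 − ε) β*(G). -/
/-- A matrix has operator norm (on `ℓ₂`) at most one. -/
def IsContraction {d : ℕ} (A : Matrix (Fin d) (Fin d) ℂ) : Prop :=
  ∀ v : Fin d → ℂ,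
    ∑ i, ‖A.mulVec v i‖ ^ 2 ≤ ∑ i, ‖v i‖ ^ 2

/-- The entangled bias of the two-player XOR game with tensor `G`, restricted to
strategies of local dimension at most `D`. -/
noncomputable def xorQBiasDim {n m : ℕ} (D : ℕ) (G : Matrix (Fin n) (Fin m) ℝ) : ℝ :=
  sSup {r : ℝ | ∃ (d : ℕ) (ψ : Fin d × Fin d → ℂ)
      (A : Fin n → Matrix (Fin d) (Fin d) ℂ) (B : Fin m → Matrix (Fin d) (Fin d) ℂ),
    1 ≤ d ∧ d ≤ D ∧ (∑ p, ‖ψ p‖ ^ 2 = 1) ∧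
    (∀ x, IsContraction (A x)) ∧ (∀ y, IsContraction (B y)) ∧
    r = ‖∑ x, ∑ y, (G x y : ℂ) *
          ∑ p : Fin d × Fin d, ∑ q : Fin d × Fin d,
            (starRingEnd ℂ) (ψ p) * (A x p.1 q.1 * B y p.2 q.2) * ψ q‖}

/-- The (unrestricted) entangled bias of the two-player XOR game with tensor `G`. -/
noncomputable def xorQBias {n m : ℕ} (G : Matrix (Fin n) (Fin m) ℝ) : ℝ :=
  sSup {r : ℝ | ∃ (d : ℕ) (ψ : Fin d × Fin d → ℂ)
      (A : Fin n → Matrix (Fin d) (Fin d) ℂ) (B : Fin m → Matrix (Fin d) (Fin d) ℂ),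
    1 ≤ d ∧ (∑ p, ‖ψ p‖ ^ 2 = 1) ∧
    (∀ x, IsContraction (A x)) ∧ (∀ y, IsContraction (B y)) ∧
    r = ‖∑ x, ∑ y, (G x y : ℂ) *
          ∑ p : Fin d × Fin d, ∑ q : Fin d × Fin d,
            (starRingEnd ℂ) (ψ p) * (A x p.1 q.1 * B y p.2 q.2) * ψ q‖}


namespace XorAux

open Matrix

lemma sketch (k : ℕ) (hk : 1 ≤ k) (N : ℕ) :
    ∃ (Ω : Type) (_ : Fintype Ω) (_ : Nonempty Ω) (L : Ω → (Fin N → ℝ) → (Fin k → ℝ)),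
      (∀ u v, ∑ ω, L ω u ⬝ᵥ L ω v = (Fintype.card Ω : ℝ) * (u ⬝ᵥ v)) ∧
      (∀ u, ∑ ω, (L ω u ⬝ᵥ L ω u - u ⬝ᵥ u) ^ 2
        ≤ (Fintype.card Ω : ℝ) * (2 / k) * (u ⬝ᵥ u) ^ 2) := by
  have hk0 : (0 : ℝ) < k := by exact_mod_cast hk
  induction N with
  | zero =>
    refine ⟨Unit, inferInstance, inferInstance, fun _ _ => 0, ?_, ?_⟩
    · intro u v; simp [dotProduct]
    · intro u; simp [dotProduct]
  | succ N ih =>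
    obtain ⟨Ω, _, _, L, h1, h2⟩ := ih
    have : Nonempty (Fin k) := ⟨⟨0, hk⟩⟩
    obtain ⟨sg, hst, hsf⟩ : ∃ sg : Bool → ℝ, sg true = 1 ∧ sg false = -1 :=
      ⟨fun b => if b then 1 else -1, by simp, by simp⟩
    have key : ∀ (u v : Fin (N + 1) → ℝ) (ω : Ω) (j : Fin k) (s : ℝ), s * s = 1 →
        (L ω (Fin.tail u) + Pi.single j (s * u 0)) ⬝ᵥ (L ω (Fin.tail v) + Pi.single j (s * v 0))
        = L ω (Fin.tail u) ⬝ᵥ L ω (Fin.tail v) + s * v 0 * L ω (Fin.tail u) j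
          + s * u 0 * L ω (Fin.tail v) j + u 0 * v 0 := by
      intro u v ω j s hs
      simp only [add_dotProduct, dotProduct_add, dotProduct_single, single_dotProduct,
        Pi.single_eq_same, Pi.add_apply]
      linear_combination (u 0 * v 0) * hs
    have hdot : ∀ u v : Fin (N + 1) → ℝ,
        u ⬝ᵥ v = u 0 * v 0 + Fin.tail u ⬝ᵥ Fin.tail v := by
      intro u v; simp [dotProduct, Fin.sum_univ_succ, Fin.tail]
    refine ⟨Ω × Fin k × Bool, inferInstance, inferInstance,
      fun ω u => L ω.1 (Fin.tail u) + Pi.single ω.2.1 (sg ω.2.2 * u 0), ?_, ?_⟩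
    · intro u v
      simp only [Fintype.sum_prod_type, Fintype.sum_bool]
      have : ∀ ω : Ω, ∀ j : Fin k,
          (L ω (Fin.tail u) + Pi.single j (sg true * u 0)) ⬝ᵥ
            (L ω (Fin.tail v) + Pi.single j (sg true * v 0)) +
          (L ω (Fin.tail u) + Pi.single j (sg false * u 0)) ⬝ᵥ
            (L ω (Fin.tail v) + Pi.single j (sg false * v 0))
          = 2 * (L ω (Fin.tail u) ⬝ᵥ L ω (Fin.tail v)) + 2 * (u 0 * v 0) := by
        intro ω j
        rw [key u v ω j _ (by simp [hst]), key u v ω j _ (by simp [hsf]), hst, hsf]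
        ring
      simp only [this]
      simp only [Finset.sum_const, Finset.card_univ, Fintype.card_fin, nsmul_eq_mul,
        ← Finset.mul_sum, Finset.sum_add_distrib, h1, hdot u v, Fintype.card_prod,
        Fintype.card_bool, Nat.cast_mul]
      push_cast; ring
    · intro u
      simp only [Fintype.sum_prod_type, Fintype.sum_bool]
      have : ∀ ω : Ω, ∀ j : Fin k,
          ((L ω (Fin.tail u) + Pi.single j (sg true * u 0)) ⬝ᵥ
            (L ω (Fin.tail u) + Pi.single j (sg true * u 0))
              - u ⬝ᵥ u) ^ 2 +
          ((L ω (Fin.tail u) + Pi.single j (sg false * u 0)) ⬝ᵥ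
            (L ω (Fin.tail u) + Pi.single j (sg false * u 0))
              - u ⬝ᵥ u) ^ 2
          = 2 * (L ω (Fin.tail u) ⬝ᵥ L ω (Fin.tail u) - Fin.tail u ⬝ᵥ Fin.tail u) ^ 2
            + 8 * u 0 ^ 2 * (L ω (Fin.tail u) j * L ω (Fin.tail u) j) := by
        intro ω j
        rw [key u u ω j _ (by simp [hst]), key u u ω j _ (by simp [hsf]), hdot u u, hst, hsf]
        ring
      simp only [this]
      have e : ∀ ω : Ω, ∑ j, (2 * (L ω (Fin.tail u) ⬝ᵥ L ω (Fin.tail u)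
            - Fin.tail u ⬝ᵥ Fin.tail u) ^ 2
            + 8 * u 0 ^ 2 * (L ω (Fin.tail u) j * L ω (Fin.tail u) j))
          = (2 * k) * (L ω (Fin.tail u) ⬝ᵥ L ω (Fin.tail u)
            - Fin.tail u ⬝ᵥ Fin.tail u) ^ 2
            + 8 * u 0 ^ 2 * (L ω (Fin.tail u) ⬝ᵥ L ω (Fin.tail u)) := by
        intro ω
        simp only [Finset.sum_add_distrib, ← Finset.mul_sum, dotProduct, Finset.sum_const, Finset.card_univ, Fintype.card_fin, nsmul_eq_mul]
        ring
      simp only [e]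
      rw [Finset.sum_add_distrib, ← Finset.mul_sum, ← Finset.mul_sum, h1]
      have h3 := mul_le_mul_of_nonneg_left (h2 (Fin.tail u)) (by positivity : (0 : ℝ) ≤ 2 * k)
      refine (add_le_add_left h3 _).trans ?_
      rw [hdot u u]
      simp only [Fintype.card_prod, Fintype.card_fin, Fintype.card_bool, Nat.cast_mul]
      have : (0 : ℝ) ≤ Fintype.card Ω * u 0 ^ 4 := by positivity
      generalize Fin.tail u ⬝ᵥ Fin.tail u = t
      field_simp
      push_cast
      nlinarith

/-- the radial retraction to the unit ball -/
noncomputable def ret {k : ℕ} (w : Fin k → ℝ) : Fin k → ℝ := (max 1 (√(w ⬝ᵥ w)))⁻¹ • w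

lemma dot_nonneg {ι : Type} [Fintype ι] (w : ι → ℝ) : 0 ≤ w ⬝ᵥ w :=
  Finset.sum_nonneg fun i _ => mul_self_nonneg _

lemma ret_le {k : ℕ} (w : Fin k → ℝ) : ret w ⬝ᵥ ret w ≤ 1 := by
  unfold ret
  rw [smul_dotProduct, dotProduct_smul, smul_eq_mul, smul_eq_mul]
  have h := Real.mul_self_sqrt (dot_nonneg w)
  have hs := Real.sqrt_nonneg (w ⬝ᵥ w)
  set s := √(w ⬝ᵥ w)
  rw [← h]
  have h1 : 1 ≤ max 1 s := le_max_left _ _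
  have h2 : s ≤ max 1 s := le_max_right _ _
  have h3 : (max 1 s)⁻¹ * s ≤ 1 := by
    rw [inv_mul_le_iff₀ (by linarith)]; linarith
  have h4 : 0 ≤ (max 1 s)⁻¹ * s := by positivity
  nlinarith

lemma ret_dist {k : ℕ} (w : Fin k → ℝ) (t : ℝ) (ht : t ≤ 1) :
    (w - ret w) ⬝ᵥ (w - ret w) ≤ (w ⬝ᵥ w - t) ^ 2 / 4 := by
  have e : w - ret w = (1 - (max 1 (√(w ⬝ᵥ w)))⁻¹) • w := by
    unfold ret; rw [sub_smul, one_smul]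
  rw [e, smul_dotProduct, dotProduct_smul, smul_eq_mul, smul_eq_mul]
  have h := Real.mul_self_sqrt (dot_nonneg w)
  have hs := Real.sqrt_nonneg (w ⬝ᵥ w)
  set s := √(w ⬝ᵥ w)
  rw [← h]
  rcases le_total s 1 with h1 | h1
  · rw [max_eq_left h1]; simp; positivity
  · rw [max_eq_right h1]
    have : (1 - s⁻¹) * ((1 - s⁻¹) * (s * s)) = (s - 1) ^ 2 := by
      have : s ≠ 0 := by linarith
      field_simp
    rw [this]
    have h2 : 2 * (s - 1) ≤ s * s - t := by nlinarith
    nlinarith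

/-- the vector value of a strategy -/
def val {n m : ℕ} (G : Matrix (Fin n) (Fin m) ℝ) {ι : Type} [Fintype ι]
    (u : Fin n → ι → ℝ) (v : Fin m → ι → ℝ) : ℝ := ∑ x, ∑ y, G x y * (u x ⬝ᵥ v y)

/-- the set of vector values -/
def vset {n m : ℕ} (G : Matrix (Fin n) (Fin m) ℝ) : Set ℝ :=
  {r | ∃ (N : ℕ) (u : Fin n → Fin N → ℝ) (v : Fin m → Fin N → ℝ),
    (∀ x, u x ⬝ᵥ u x ≤ 1) ∧ (∀ y, v y ⬝ᵥ v y ≤ 1) ∧ r = val G u v}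

lemma bdd_vset {n m : ℕ} (G : Matrix (Fin n) (Fin m) ℝ) : BddAbove (vset G) := by
  refine ⟨∑ x, ∑ y, |G x y|, ?_⟩
  rintro r ⟨N, u, v, hu, hv, rfl⟩
  refine Finset.sum_le_sum fun x _ => Finset.sum_le_sum fun y _ => ?_
  have h1 := dot_nonneg (u x - v y)
  have h2 := dot_nonneg (u x + v y)
  simp only [sub_dotProduct, dotProduct_sub, add_dotProduct, dotProduct_add] at h1 h2
  rw [dotProduct_comm (v y) (u x)] at h1 h2
  have : |u x ⬝ᵥ v y| ≤ 1 := abs_le.2 ⟨by linarith [hu x, hv y], by linarith [hu x, hv y]⟩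
  calc G x y * (u x ⬝ᵥ v y) ≤ |G x y * (u x ⬝ᵥ v y)| := le_abs_self _
    _ = |G x y| * |u x ⬝ᵥ v y| := abs_mul _ _
    _ ≤ |G x y| * 1 := by gcongr
    _ = _ := mul_one _

lemma V_nonneg {n m : ℕ} (G : Matrix (Fin n) (Fin m) ℝ) : 0 ≤ sSup (vset G) :=
  le_csSup (bdd_vset G) ⟨0, 0, 0, by simp, by simp, by simp [val]⟩

lemma val_le {n m : ℕ} (G : Matrix (Fin n) (Fin m) ℝ) {ι : Type} [Fintype ι]
    (u : Fin n → ι → ℝ) (v : Fin m → ι → ℝ) (a b : ℝ) (ha : 0 < a) (hb : 0 < b)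
    (hu : ∀ x, u x ⬝ᵥ u x ≤ a ^ 2) (hv : ∀ y, v y ⬝ᵥ v y ≤ b ^ 2) :
    val G u v ≤ a * b * sSup (vset G) := by
  let e := (Fintype.equivFin ι).symm
  have hd : ∀ p q : ι → ℝ, (p ∘ e) ⬝ᵥ (q ∘ e) = p ⬝ᵥ q := by
    intro p q
    exact Equiv.sum_comp e (fun i => p i * q i)
  have : val G (fun x => a⁻¹ • (u x ∘ e)) (fun y => b⁻¹ • (v y ∘ e)) ≤ sSup (vset G) := by
    refine le_csSup (bdd_vset G) ⟨_, _, _, ?_, ?_, rfl⟩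
    · intro x
      rw [smul_dotProduct, dotProduct_smul, hd, smul_eq_mul, smul_eq_mul, ← mul_assoc, ← mul_inv,
        inv_mul_le_iff₀ (by positivity)]
      linarith [hu x]
    · intro x
      rw [smul_dotProduct, dotProduct_smul, hd, smul_eq_mul, smul_eq_mul, ← mul_assoc, ← mul_inv,
        inv_mul_le_iff₀ (by positivity)]
      linarith [hv x]
  have e2 : val G (fun x => a⁻¹ • (u x ∘ e)) (fun y => b⁻¹ • (v y ∘ e))
      = (a * b)⁻¹ * val G u v := by
    unfold val
    simp only [Finset.mul_sum, smul_dotProduct, dotProduct_smul, hd, smul_eq_mul, mul_inv]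
    refine Finset.sum_congr rfl fun x _ => Finset.sum_congr rfl fun y _ => ?_
    ring
  rw [e2, inv_mul_le_iff₀ (by positivity)] at this
  exact this

lemma rounding {n m : ℕ} (G : Matrix (Fin n) (Fin m) ℝ) (k : ℕ) (hk : 1 ≤ k) (ε : ℝ)
    (hε : 0 < ε) (hkε : 2 ≤ k * ε ^ 2) (N : ℕ)
    (u : Fin n → Fin N → ℝ) (v : Fin m → Fin N → ℝ)
    (hu : ∀ x, u x ⬝ᵥ u x ≤ 1) (hv : ∀ y, v y ⬝ᵥ v y ≤ 1) :
    ∃ (u' : Fin n → Fin k → ℝ) (v' : Fin m → Fin k → ℝ),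
      (∀ x, u' x ⬝ᵥ u' x ≤ 1) ∧ (∀ y, v' y ⬝ᵥ v' y ≤ 1) ∧
      val G u v - ε * sSup (vset G) ≤ val G u' v' := by
  obtain ⟨Ω, _, _, L, h1, h2⟩ := sketch k hk N
  have hk0 : (0 : ℝ) < k := by exact_mod_cast hk
  have hc : (0 : ℝ) < Fintype.card Ω := by exact_mod_cast Fintype.card_pos
  set c : ℝ := ((Fintype.card Ω : ℕ) : ℝ) with hcdef
  set V := sSup (vset G)
  have hsq : √c ^ 2 = c := Real.sq_sqrt hc.le
  have hsp : 0 < √c := Real.sqrt_pos.2 hc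
  have hd : ∀ p q : Ω → Fin k → ℝ, (fun i : Ω × Fin k => p i.1 i.2) ⬝ᵥ (fun i => q i.1 i.2)
      = ∑ ω, p ω ⬝ᵥ q ω := by
    intro p q; simp [dotProduct, Fintype.sum_prod_type]
  have hv2 : ∀ (p : Fin n → Ω → Fin k → ℝ) (q : Fin m → Ω → Fin k → ℝ),
      val G (fun x (i : Ω × Fin k) => p x i.1 i.2) (fun y i => q y i.1 i.2)
        = ∑ ω, val G (fun x => p x ω) (fun y => q y ω) := by
    intro p q
    unfold val
    simp only [hd, Finset.mul_sum]
    rw [Finset.sum_comm]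
    simp only [Finset.sum_comm (s := (Finset.univ : Finset Ω))]
    rw [Finset.sum_comm]
  have hdist : ∀ w : Fin N → ℝ, w ⬝ᵥ w ≤ 1 →
      ∑ ω, (L ω w - ret (L ω w)) ⬝ᵥ (L ω w - ret (L ω w)) ≤ (√c * (ε / 2)) ^ 2 := by
    intro w hw
    calc _ ≤ ∑ ω, (L ω w ⬝ᵥ L ω w - w ⬝ᵥ w) ^ 2 / 4 :=
          Finset.sum_le_sum fun ω _ => ret_dist _ _ hw
      _ = (∑ ω, (L ω w ⬝ᵥ L ω w - w ⬝ᵥ w) ^ 2) / 4 := by rw [Finset.sum_div]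
      _ ≤ (c * (2 / k) * (w ⬝ᵥ w) ^ 2) / 4 := by gcongr; exact h2 w
      _ ≤ (c * (2 / k) * 1 ^ 2) / 4 := by
          have := dot_nonneg w
          gcongr
      _ ≤ (c * ε ^ 2 * 1 ^ 2) / 4 := by
          have : 2 / (k : ℝ) ≤ ε ^ 2 := by rw [div_le_iff₀ hk0]; linarith
          gcongr
      _ = _ := by rw [mul_pow, hsq]; ring
  have t1 : val G (fun x (i : Ω × Fin k) => (L i.1 (u x) - ret (L i.1 (u x))) i.2)
      (fun y i => L i.1 (v y) i.2) ≤ (√c * (ε / 2)) * √c * V := by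
    apply val_le _ _ _ _ _ (by positivity) hsp
    · intro x
      rw [hd (fun ω => L ω (u x) - ret (L ω (u x))) (fun ω => L ω (u x) - ret (L ω (u x)))]
      exact hdist _ (hu x)
    · intro y
      rw [hd (fun ω => L ω (v y)) (fun ω => L ω (v y)), h1, hsq]
      nlinarith [hv y]
  have t2 : val G (fun x (i : Ω × Fin k) => (ret (L i.1 (u x))) i.2)
      (fun y i => (L i.1 (v y) - ret (L i.1 (v y))) i.2) ≤ √c * (√c * (ε / 2)) * V := by
    apply val_le _ _ _ _ _ hsp (by positivity)
    · intro x
      rw [hd (fun ω => ret (L ω (u x))) (fun ω => ret (L ω (u x))), hsq]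
      refine (Finset.sum_le_sum fun ω _ => ret_le (L ω (u x))).trans ?_
      simp [hcdef]
    · intro y
      rw [hd (fun ω => L ω (v y) - ret (L ω (v y))) (fun ω => L ω (v y) - ret (L ω (v y)))]
      exact hdist _ (hv y)
  have t0 : ∑ ω, val G (fun x => L ω (u x)) (fun y => L ω (v y)) = c * val G u v := by
    rw [← hv2 (fun x ω => L ω (u x)) (fun y ω => L ω (v y))]
    unfold val
    simp only [Finset.mul_sum]
    refine Finset.sum_congr rfl fun x _ => Finset.sum_congr rfl fun y _ => ?_
    rw [hd (fun ω => L ω (u x)) (fun ω => L ω (v y)), h1]; ring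
  rw [hv2 (fun x ω => L ω (u x) - ret (L ω (u x))) (fun y ω => L ω (v y))] at t1
  rw [hv2 (fun x ω => ret (L ω (u x))) (fun y ω => L ω (v y) - ret (L ω (v y)))] at t2
  have t3 : ∀ ω, val G (fun x => ret (L ω (u x))) (fun y => ret (L ω (v y)))
      = val G (fun x => L ω (u x)) (fun y => L ω (v y))
        - val G (fun x => L ω (u x) - ret (L ω (u x))) (fun y => L ω (v y))
        - val G (fun x => ret (L ω (u x))) (fun y => L ω (v y) - ret (L ω (v y))) := by
    intro ω
    unfold val
    simp only [← Finset.sum_sub_distrib]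
    refine Finset.sum_congr rfl fun x _ => Finset.sum_congr rfl fun y _ => ?_
    rw [sub_dotProduct, dotProduct_sub]; ring
  have t4 : ∑ _ω : Ω, (val G u v - ε * V)
      ≤ ∑ ω, val G (fun x => ret (L ω (u x))) (fun y => ret (L ω (v y))) := by
    simp only [t3, Finset.sum_sub_distrib, t0]
    simp only [Finset.sum_const, Finset.card_univ, nsmul_eq_mul, ← hcdef]
    have e1 : √c * (ε / 2) * √c * V = c * (ε * V) / 2 := by
      linear_combination (ε / 2 * V) * hsq
    have e2 : √c * (√c * (ε / 2)) * V = c * (ε * V) / 2 := by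
      linear_combination (ε / 2 * V) * hsq
    rw [e1] at t1
    rw [e2] at t2
    linarith
  obtain ⟨ω, -, hω⟩ := Finset.exists_le_of_sum_le Finset.univ_nonempty t4
  exact ⟨_, _, fun x => ret_le _, fun y => ret_le _, hω⟩

lemma clifford (r : ℕ) : ∃ (I : Type) (_ : Fintype I) (_ : DecidableEq I)
    (M : (Fin (r + 1) → ℝ) → Matrix I I ℝ), Fintype.card I = 2 ^ r ∧
      (∀ u, (M u)ᵀ = M u) ∧
      (∀ u v, M u * M v + M v * M u = (2 * (u ⬝ᵥ v)) • (1 : Matrix I I ℝ)) := by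
  induction r with
  | zero =>
    refine ⟨Unit, inferInstance, inferInstance, fun u => u 0 • 1, by simp, by simp, ?_⟩
    intro u v
    simp [dotProduct, smul_smul, ← add_smul]
    congr 1; ring
  | succ r ih =>
    obtain ⟨I, _, _, M, hI, h1, h2⟩ := ih
    refine ⟨I ⊕ I, inferInstance, inferInstance,
      fun u => fromBlocks (M (Fin.tail u)) (u 0 • 1) (u 0 • 1) (-M (Fin.tail u)), ?_, ?_, ?_⟩
    · rw [Fintype.card_sum, hI]; ring
    · intro u; simp [fromBlocks_transpose, h1]
    · intro u v
      have hdot : u ⬝ᵥ v = u 0 * v 0 + Fin.tail u ⬝ᵥ Fin.tail v := by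
        simp [dotProduct, Fin.sum_univ_succ, Fin.tail]
      have h := h2 (Fin.tail u) (Fin.tail v)
      rw [← fromBlocks_one, fromBlocks_smul, fromBlocks_multiply, fromBlocks_multiply,
        fromBlocks_add, hdot]
      congr 1
      · have : (2 * (u 0 * v 0 + Fin.tail u ⬝ᵥ Fin.tail v)) • (1 : Matrix I I ℝ)
          = (2 * (u 0 * v 0)) • 1 + (2 * (Fin.tail u ⬝ᵥ Fin.tail v)) • 1 := by
          rw [← add_smul]; ring_nf
        rw [this, ← h]
        simp [smul_smul]
        rw [mul_comm (v 0) (u 0), two_mul, add_smul]; abel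
      · simp
      · simp
      · have : (2 * (u 0 * v 0 + Fin.tail u ⬝ᵥ Fin.tail v)) • (1 : Matrix I I ℝ)
          = (2 * (u 0 * v 0)) • 1 + (2 * (Fin.tail u ⬝ᵥ Fin.tail v)) • 1 := by
          rw [← add_smul]; ring_nf
        rw [this, ← h]
        simp [smul_smul]
        rw [mul_comm (v 0) (u 0), two_mul, add_smul]; abel

lemma cliffordFin (r : ℕ) : ∃ (M : (Fin (r + 1) → ℝ) → Matrix (Fin (2 ^ r)) (Fin (2 ^ r)) ℝ),
      (∀ u, (M u)ᵀ = M u) ∧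
      (∀ u v, M u * M v + M v * M u = (2 * (u ⬝ᵥ v)) • 1) := by
  obtain ⟨I, _, _, M, hI, h1, h2⟩ := clifford r
  let e : Fin (2 ^ r) ≃ I := (Fintype.equivFinOfCardEq hI).symm
  refine ⟨fun u => (M u).submatrix e e, ?_, ?_⟩
  · intro u; rw [transpose_submatrix, h1]
  · intro u v
    rw [submatrix_mul_equiv, submatrix_mul_equiv]
    ext i j
    have := congrFun (congrFun (h2 u v) (e i)) (e j)
    simpa [one_apply] using this

lemma contraction_of {d : ℕ} (A : Matrix (Fin d) (Fin d) ℝ) (hA : Aᵀ = A) (t : ℝ) (ht : t ≤ 1)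
    (h : A * A = t • 1) : IsContraction (A.map (fun x : ℝ => (x : ℂ))) := by
  have real : ∀ w : Fin d → ℝ, ∑ i, (A *ᵥ w) i ^ 2 ≤ ∑ i, w i ^ 2 := by
    intro w
    have e : (A *ᵥ w) ⬝ᵥ (A *ᵥ w) = t * (w ⬝ᵥ w) := by
      rw [dotProduct_mulVec, ← mulVec_transpose, hA, mulVec_mulVec, h, smul_mulVec, one_mulVec,
        smul_dotProduct, smul_eq_mul]
    have := dot_nonneg w
    have e2 : (A *ᵥ w) ⬝ᵥ (A *ᵥ w) ≤ w ⬝ᵥ w := by rw [e]; nlinarith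
    simpa [dotProduct, sq] using e2
  intro v
  have h1 := real (fun i => (v i).re)
  have h2 := real (fun i => (v i).im)
  have e : ∀ i, ‖(A.map (fun x : ℝ => (x : ℂ)) *ᵥ v) i‖ ^ 2
      = (A *ᵥ fun i => (v i).re) i ^ 2 + (A *ᵥ fun i => (v i).im) i ^ 2 := by
    intro i
    rw [Complex.sq_norm, Complex.normSq_apply]
    simp [mulVec, dotProduct, Complex.re_sum, Complex.im_sum, sq]
  have e' : ∀ i, ‖v i‖ ^ 2 = (v i).re ^ 2 + (v i).im ^ 2 := by
    intro i; rw [Complex.sq_norm, Complex.normSq_apply]; ring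
  simp only [e, e', Finset.sum_add_distrib]
  linarith

lemma adj_contraction {d : ℕ} (A : Matrix (Fin d) (Fin d) ℂ) (hA : IsContraction A)
    (v : Fin d → ℂ) : ∑ j, ‖∑ i, (starRingEnd ℂ) (v i) * A i j‖ ^ 2 ≤ ∑ i, ‖v i‖ ^ 2 := by
  set w : Fin d → ℂ := fun j => ∑ i, (starRingEnd ℂ) (v i) * A i j with hw
  have h := hA (fun j => (starRingEnd ℂ) (w j))
  simp only [RCLike.norm_conj] at h
  have e : ((∑ j, ‖w j‖ ^ 2 : ℝ) : ℂ)
      = ∑ i, (starRingEnd ℂ) (v i) * (A *ᵥ fun j => (starRingEnd ℂ) (w j)) i := by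
    push_cast
    simp only [mulVec, dotProduct, Finset.mul_sum]
    rw [Finset.sum_comm]
    refine Finset.sum_congr rfl fun j _ => ?_
    rw [← Complex.mul_conj']
    conv_lhs => rw [hw]
    simp only [Finset.sum_mul]
    refine Finset.sum_congr rfl fun i _ => ?_
    ring
  have e2 : ∑ j, ‖w j‖ ^ 2
      ≤ ∑ i, (‖v i‖ ^ 2 + ‖(A *ᵥ fun j => (starRingEnd ℂ) (w j)) i‖ ^ 2) / 2 := by
    have h0 : ∑ j, ‖w j‖ ^ 2 = ‖((∑ j, ‖w j‖ ^ 2 : ℝ) : ℂ)‖ := by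
      rw [Complex.norm_real, Real.norm_of_nonneg (by positivity)]
    rw [h0, e]
    refine (norm_sum_le _ _).trans (Finset.sum_le_sum fun i _ => ?_)
    rw [norm_mul, RCLike.norm_conj]
    nlinarith [sq_nonneg (‖v i‖ - ‖(A *ᵥ fun j => (starRingEnd ℂ) (w j)) i‖)]
  rw [← Finset.sum_div, Finset.sum_add_distrib] at e2
  linarith

lemma upper {n m : ℕ} (G : Matrix (Fin n) (Fin m) ℝ) (d : ℕ) (ψ : Fin d × Fin d → ℂ)
    (A : Fin n → Matrix (Fin d) (Fin d) ℂ) (B : Fin m → Matrix (Fin d) (Fin d) ℂ)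
    (hψ : ∑ p, ‖ψ p‖ ^ 2 = 1)
    (hA : ∀ x, IsContraction (A x)) (hB : ∀ y, IsContraction (B y)) :
    ‖∑ x, ∑ y, (G x y : ℂ) *
          ∑ p : Fin d × Fin d, ∑ q : Fin d × Fin d,
            (starRingEnd ℂ) (ψ p) * (A x p.1 q.1 * B y p.2 q.2) * ψ q‖ ≤ sSup (vset G) := by
  set z := ∑ x, ∑ y, (G x y : ℂ) *
          ∑ p : Fin d × Fin d, ∑ q : Fin d × Fin d,
            (starRingEnd ℂ) (ψ p) * (A x p.1 q.1 * B y p.2 q.2) * ψ q with hz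
  obtain ⟨c, hc, hcz⟩ : ∃ c : ℂ, ‖c‖ = 1 ∧ (c * z).re = ‖z‖ := by
    by_cases h : z = 0
    · exact ⟨1, by simp, by simp [h]⟩
    · have hn : (‖z‖ : ℂ) ≠ 0 := by simpa using h
      refine ⟨(starRingEnd ℂ) z / ‖z‖, ?_, ?_⟩
      · rw [norm_div, RCLike.norm_conj, Complex.norm_real, norm_norm, div_self (by simpa using h)]
      · have : (starRingEnd ℂ) z / ‖z‖ * z = (‖z‖ : ℂ) := by
          rw [div_mul_eq_mul_div, Complex.conj_mul']
          field_simp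
        rw [this]; simp
  let α : Fin n → Fin d × Fin d → ℂ := fun x s => c * ∑ i, (starRingEnd ℂ) (ψ (i, s.2)) * A x i s.1
  let β : Fin m → Fin d × Fin d → ℂ := fun y s => ∑ j, B y s.2 j * ψ (s.1, j)
  have hw : ∀ x y, c * (∑ p : Fin d × Fin d, ∑ q : Fin d × Fin d,
            (starRingEnd ℂ) (ψ p) * (A x p.1 q.1 * B y p.2 q.2) * ψ q)
            = ∑ s, α x s * β y s := by
    intro x y
    simp only [α, β, Fintype.sum_prod_type, mul_assoc, ← Finset.mul_sum]
    congr 1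
    simp only [Finset.sum_mul, Finset.mul_sum]
    -- p1 p2 q1 q2 to q1 p2 p1 q2 
    rw [Finset.sum_comm]
    conv_rhs => rw [Finset.sum_comm]
    refine Finset.sum_congr rfl fun p2 _ => ?_
    rw [Finset.sum_comm]
    refine Finset.sum_congr rfl fun q1 _ => ?_
    first
    | (refine Finset.sum_congr rfl fun a _ => Finset.sum_congr rfl fun b _ => ?_
       ring1)
    | (rw [Finset.sum_comm]
       refine Finset.sum_congr rfl fun a _ => Finset.sum_congr rfl fun b _ => ?_
       ring1)
  let u : Fin n → (Fin d × Fin d) ⊕ (Fin d × Fin d) → ℝ := fun x =>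
    Sum.elim (fun s => (α x s).re) (fun s => -(α x s).im)
  let v : Fin m → (Fin d × Fin d) ⊕ (Fin d × Fin d) → ℝ := fun x =>
    Sum.elim (fun s => (β x s).re) (fun s => (β x s).im)
  have hval : ‖z‖ = val G u v := by
    rw [← hcz, hz, val]
    simp only [Finset.mul_sum, Complex.re_sum]
    refine Finset.sum_congr rfl fun x _ => ?_
    refine Finset.sum_congr rfl fun y _ => ?_
    have h1 := congrArg Complex.re (hw x y)
    have h2 : (∑ s, α x s * β y s).re = u x ⬝ᵥ v y := by
      simp [u, v, dotProduct, Fintype.sum_sum_type, Complex.re_sum, Finset.sum_add_distrib,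
        Finset.sum_neg_distrib, sub_eq_add_neg]
    rw [h2] at h1
    rw [← h1, ← Complex.re_ofReal_mul]
    simp only [Finset.mul_sum, Complex.re_sum]
    refine Finset.sum_congr rfl fun p _ => Finset.sum_congr rfl fun q _ => ?_
    congr 1; ring
  have hsq : ∀ a : ℂ, ‖a‖ ^ 2 = a.re * a.re + a.im * a.im := by
    intro a; rw [Complex.sq_norm, Complex.normSq_apply]
  rw [hval, ← one_mul (sSup _), ← one_mul (1 : ℝ)]
  apply val_le _ _ _ _ _ one_pos one_pos
  · intro x
    have : u x ⬝ᵥ u x = ∑ s, ‖α x s‖ ^ 2 := by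
      simp [u, dotProduct, Fintype.sum_sum_type, hsq, Finset.sum_add_distrib]
    rw [this, one_pow, ← hψ]
    simp only [α, norm_mul, hc, one_mul]
    rw [Fintype.sum_prod_type_right, Fintype.sum_prod_type_right]
    exact Finset.sum_le_sum fun j _ => adj_contraction (A x) (hA x) (fun i => ψ (i, j))
  · intro y
    have : v y ⬝ᵥ v y = ∑ s, ‖β y s‖ ^ 2 := by
      simp [v, dotProduct, Fintype.sum_sum_type, hsq, Finset.sum_add_distrib]
    rw [this, one_pow, ← hψ]
    simp only [β]
    rw [Fintype.sum_prod_type, Fintype.sum_prod_type]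
    exact Finset.sum_le_sum fun j _ => hB y (fun i => ψ (j, i))

lemma lower {n m : ℕ} (G : Matrix (Fin n) (Fin m) ℝ) (r : ℕ)
    (u : Fin n → Fin (r + 1) → ℝ) (v : Fin m → Fin (r + 1) → ℝ)
    (hu : ∀ x, u x ⬝ᵥ u x ≤ 1) (hv : ∀ y, v y ⬝ᵥ v y ≤ 1) :
    val G u v ≤ xorQBiasDim (2 ^ r) G := by
  obtain ⟨M, h1, h2⟩ := cliffordFin r
  have hbdd : BddAbove {r' : ℝ | ∃ (d : ℕ) (ψ : Fin d × Fin d → ℂ)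
      (A : Fin n → Matrix (Fin d) (Fin d) ℂ) (B : Fin m → Matrix (Fin d) (Fin d) ℂ),
    1 ≤ d ∧ d ≤ 2 ^ r ∧ (∑ p, ‖ψ p‖ ^ 2 = 1) ∧
    (∀ x, IsContraction (A x)) ∧ (∀ y, IsContraction (B y)) ∧
    r' = ‖∑ x, ∑ y, (G x y : ℂ) *
          ∑ p : Fin d × Fin d, ∑ q : Fin d × Fin d,
            (starRingEnd ℂ) (ψ p) * (A x p.1 q.1 * B y p.2 q.2) * ψ q‖} := by
    refine ⟨sSup (vset G), ?_⟩
    rintro _ ⟨d, ψ, A, B, -, -, hψ, hA, hB, rfl⟩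
    exact upper G d ψ A B hψ hA hB
  have hsq : ∀ w, M w * M w = (w ⬝ᵥ w) • 1 := by
    intro w
    have := h2 w w
    rw [← two_smul ℝ, mul_smul] at this
    exact smul_right_injective _ (two_ne_zero) this
  have hD : (0 : ℝ) < 2 ^ r := by positivity
  have htr : ∀ a b, ∑ i, ∑ j, M a i j * M b i j = 2 ^ r * (a ⬝ᵥ b) := by
    intro a b
    have h := congrArg trace (h2 a b)
    rw [trace_add, trace_mul_comm (M b) (M a), trace_smul, trace_one] at h
    have h' : trace (M a * M b) = ∑ i, ∑ j, M a i j * M b i j := by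
      simp only [trace, diag, mul_apply]
      refine Finset.sum_congr rfl fun i _ => Finset.sum_congr rfl fun j _ => ?_
      conv_lhs => rw [← h1 b]
      rfl
    rw [h'] at h
    simp at h
    linarith
  let ψ : Fin (2 ^ r) × Fin (2 ^ r) → ℂ := fun p => if p.1 = p.2 then ((√(2 ^ r))⁻¹ : ℝ) else 0
  have hs : (√(2 ^ r : ℝ))⁻¹ * (√(2 ^ r))⁻¹ = (2 ^ r)⁻¹ := by
    rw [← mul_inv, Real.mul_self_sqrt hD.le]
  refine le_trans (le_abs_self _) ?_
  refine le_csSup hbdd ⟨2 ^ r, ψ, fun x => (M (u x)).map (fun x : ℝ => (x : ℂ)),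
    fun y => (M (v y)).map (fun x : ℝ => (x : ℂ)), Nat.one_le_two_pow, le_rfl, ?_, ?_, ?_, ?_⟩
  · have : ∀ p, ‖ψ p‖ ^ 2 = if p.1 = p.2 then (2 ^ r : ℝ)⁻¹ else 0 := by
      intro p
      simp only [ψ]
      split_ifs
      · rw [Complex.norm_real, Real.norm_eq_abs, sq_abs, sq, hs]
      · simp
    simp only [this, Fintype.sum_prod_type]
    simp
  · exact fun x => contraction_of _ (h1 _) _ (hu x) (hsq _)
  · exact fun x => contraction_of _ (h1 _) _ (hv x) (hsq _)
  · have hw : ∀ x y, ∑ p : Fin (2 ^ r) × Fin (2 ^ r), ∑ q : Fin (2 ^ r) × Fin (2 ^ r),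
        (starRingEnd ℂ) (ψ p) * ((M (u x)).map (fun x : ℝ => (x : ℂ)) p.1 q.1 *
          (M (v y)).map (fun x : ℝ => (x : ℂ)) p.2 q.2) * ψ q = ((u x ⬝ᵥ v y : ℝ) : ℂ) := by
      intro x y
      have e : u x ⬝ᵥ v y = ∑ i, ∑ j, (√(2 ^ r : ℝ))⁻¹ * (M (u x) i j * M (v y) i j)
          * (√(2 ^ r : ℝ))⁻¹ := by
        have : ∀ i j, (√(2 ^ r : ℝ))⁻¹ * (M (u x) i j * M (v y) i j) * (√(2 ^ r : ℝ))⁻¹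
            = (2 ^ r)⁻¹ * (M (u x) i j * M (v y) i j) := by
          intro i j; rw [← hs]; ring
        simp only [this, ← Finset.mul_sum, htr]
        field_simp
      rw [e]
      simp only [ψ, Fintype.sum_prod_type, apply_ite (starRingEnd ℂ), map_zero, ite_mul, mul_ite,
        zero_mul, mul_zero, Finset.sum_ite_eq, Finset.mem_univ, if_true, map_apply,
        Complex.conj_ofReal, Finset.sum_ite_irrel, Finset.sum_const_zero]
      push_cast
      rfl
    simp only [hw]
    rw [val, ← Real.norm_eq_abs, ← Complex.norm_real]
    push_cast
    rfl

end XorAux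

/-- near-optimal XOR strategies in bounded dimension: for every real
matrix `G` and every `ε ∈ (0,1)`, setting `D = 2^⌊2/ε²⌋`, one has
`β*_D(G) ≥ (1 − ε) β*(G)`. -/
theorem stmt18 {n m : ℕ} (G : Matrix (Fin n) (Fin m) ℝ)
    (ε : ℝ) (hε0 : 0 < ε) (hε1 : ε < 1) :
    (1 - ε) * xorQBias G ≤ xorQBiasDim (2 ^ (Nat.floor (2 / ε ^ 2))) G := by
  set r := Nat.floor (2 / ε ^ 2) with hr
  have hub : xorQBias G ≤ sSup (XorAux.vset G) := by
    apply Real.sSup_le _ (XorAux.V_nonneg G)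
    rintro _ ⟨d, ψ, A, B, -, hψ, hA, hB, rfl⟩
    exact XorAux.upper G d ψ A B hψ hA hB
  have hk : 2 ≤ ((r + 1 : ℕ) : ℝ) * ε ^ 2 := by
    have h := (Nat.lt_floor_add_one (2 / ε ^ 2)).le
    rw [div_le_iff₀ (by positivity)] at h
    push_cast
    exact h
  have h : sSup (XorAux.vset G) ≤ xorQBiasDim (2 ^ r) G + ε * sSup (XorAux.vset G) := by
    have hne : (XorAux.vset G).Nonempty := ⟨0, 0, 0, 0, by simp, by simp, by simp [XorAux.val]⟩
    apply csSup_le hne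
    rintro _ ⟨N, u, v, hu, hv, rfl⟩
    obtain ⟨u', v', hu', hv', h⟩ :=
      XorAux.rounding G (r + 1) (by omega) ε hε0 hk N u v hu hv
    linarith [XorAux.lower G r u' v' hu' hv']
  nlinarith
end
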